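/- arXiv:1511.02296 — 2 statements merged into one kernel-verified Lean document; each statement's English description precedes it below -/
import Mathlib

section
/- Let D₀ = D₀¹ × ⋯ × D₀ⁿ be a product probability distribution on [0,∞)ⁿ in which each coordinate distribution D₀ⁱ has finite support. Then there exists a measurable DSIC and IR mechanism M₀ with Rev(M₀, D₀) = Opt(D₀) such that for every product probability distribution D = D¹ × ⋯ × Dⁿ on [0,∞)ⁿ with finite support satisfying D ⪰ D₀ (component-wise first-order stochastic dominance), Rev(M₀, D) ≥ Rev(M₀, D₀). -/
open MeasureTheory

/-- A (direct-revelation) mechanism for `n` buyers and one item: an allocation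
rule and a payment rule on value profiles. -/
structure Mech (n : ℕ) where
  alloc : (Fin n → ℝ) → Fin n → ℝ
  pay : (Fin n → ℝ) → Fin n → ℝ

/-- Allocation probabilities are in `[0,1]` and sum to at most `1`. -/
def Mech.Valid {n : ℕ} (M : Mech n) : Prop :=
  ∀ v : Fin n → ℝ, (∀ i, 0 ≤ M.alloc v i ∧ M.alloc v i ≤ 1) ∧ ∑ i, M.alloc v i ≤ 1

/-- Dominant strategy incentive compatibility (on nonnegative value profiles). -/
def Mech.DSIC {n : ℕ} (M : Mech n) : Prop :=
  ∀ (i : Fin n) (v : Fin n → ℝ), (∀ j, 0 ≤ v j) → ∀ v' : ℝ, 0 ≤ v' →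
    v i * M.alloc (Function.update v i v') i - M.pay (Function.update v i v') i ≤
      v i * M.alloc v i - M.pay v i

/-- Individual rationality (on nonnegative value profiles). -/
def Mech.IR {n : ℕ} (M : Mech n) : Prop :=
  ∀ v : Fin n → ℝ, (∀ j, 0 ≤ v j) → ∀ i, 0 ≤ v i * M.alloc v i - M.pay v i

/-- Measurability of the allocation and payment rules. -/
def Mech.Meas {n : ℕ} (M : Mech n) : Prop :=
  (∀ i, Measurable fun v => M.alloc v i) ∧ (∀ i, Measurable fun v => M.pay v i)

/-- A measurable DSIC and IR mechanism. -/
def Mech.Good {n : ℕ} (M : Mech n) : Prop := M.Valid ∧ M.DSIC ∧ M.IR ∧ M.Meas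

/-- Expected revenue of mechanism `M` on value distribution `D`. -/
noncomputable def Rev {n : ℕ} (M : Mech n) (D : Measure (Fin n → ℝ)) : ℝ :=
  ∫ v, ∑ i, M.pay v i ∂D

/-- Optimal revenue: supremum of revenue over measurable DSIC and IR mechanisms. -/
noncomputable def Opt {n : ℕ} (D : Measure (Fin n → ℝ)) : ℝ :=
  sSup {r : ℝ | ∃ M : Mech n, M.Good ∧ r = Rev M D}

/-- First-order stochastic dominance: `D ⪰ D'`. -/
def FOSD (D D' : Measure ℝ) : Prop := ∀ t : ℝ, D (Set.Iic t) ≤ D' (Set.Iic t)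

/-- A distribution with finite support. -/
def FiniteSupport (D : Measure ℝ) : Prop := ∃ s : Finset ℝ, D ((↑s : Set ℝ)ᶜ) = 0

namespace RevMon
open ProbabilityTheory

lemma proj_mono (k : ℕ) (f c : Fin k → ℝ) (hf : ∀ j, 0 < f j) :
    ∃ ψ : Fin k → ℝ, Monotone ψ ∧
      ∀ w : Fin k → ℝ, Monotone w → ∑ j, (c j - f j * ψ j) * (w j - ψ j) ≤ 0 := by
  let K : Set (EuclideanSpace ℝ (Fin k)) :=
    {y | ∀ i j : Fin k, i ≤ j → y i / √(f i) ≤ y j / √(f j)}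
  have hne : K.Nonempty := ⟨0, fun i j _ => by simp⟩
  have hcl : IsClosed K := by
    simp only [K, Set.ofPred_forall]
    refine isClosed_iInter fun i => isClosed_iInter fun j => isClosed_iInter fun _ => ?_
    exact isClosed_le (by fun_prop) (by fun_prop)
  have hconv : Convex ℝ K := by
    intro x hx y hy s t hs ht hst i j hij
    have h1 := mul_le_mul_of_nonneg_left (hx i j hij) hs
    have h2 := mul_le_mul_of_nonneg_left (hy i j hij) ht
    simp only [PiLp.add_apply, PiLp.smul_apply, smul_eq_mul, add_div, mul_div_assoc]
    linarith
  have hs : ∀ j, 0 < √(f j) := fun j => Real.sqrt_pos.2 (hf j)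
  obtain ⟨y, hyK, hy⟩ := exists_norm_eq_iInf_of_complete_convex hne hcl.isComplete hconv
    (WithLp.toLp 2 (fun j => c j / √(f j)))
  rw [norm_eq_iInf_iff_real_inner_le_zero hconv hyK] at hy
  refine ⟨fun j => y j / √(f j), fun i j hij => hyK i j hij, fun w hw => ?_⟩
  have := hy (WithLp.toLp 2 (fun j => √(f j) * w j)) (fun i j hij => by
    have h1 := (hs i).ne'
    have h2 := (hs j).ne'
    simpa [mul_div_assoc, mul_div_cancel_left₀, h1, h2] using hw hij)
  refine le_trans (le_of_eq ?_) this
  simp only [PiLp.inner_apply, PiLp.sub_apply]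
  refine Finset.sum_congr rfl fun j _ => ?_
  have h1 := (hs j).ne'
  have h2 : √(f j) * √(f j) = f j := Real.mul_self_sqrt (hf j).le
  have h3 : (inner ℝ (c j / √(f j) - y j) (√(f j) * w j - y j) : ℝ)
    = (c j / √(f j) - y j) * (√(f j) * w j - y j) := by simp [mul_comm]
  rw [h3]
  generalize √(f j) = r at *
  rw [← h2]
  field_simp

noncomputable def qf (μ : Measure ℝ) (q : ℝ) : ℝ :=
  open Classical in if q ∈ Set.Ioo (0:ℝ) 1 then sInf {x | q ≤ cdf μ x} else 0

lemma qf_bdd (μ : Measure ℝ) [IsProbabilityMeasure μ] {q : ℝ} (hq : q ∈ Set.Ioo (0:ℝ) 1) :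
    BddBelow {x | q ≤ cdf μ x} := by
  obtain ⟨x0, hx0⟩ := ((tendsto_cdf_atBot μ).eventually (gt_mem_nhds hq.1)).exists
  refine ⟨x0, fun x hx => ?_⟩
  by_contra h
  exact absurd (lt_of_le_of_lt (monotone_cdf μ (not_le.1 h).le) hx0) (not_lt.2 hx)

lemma qf_ne (μ : Measure ℝ) [IsProbabilityMeasure μ] {q : ℝ} (hq : q ∈ Set.Ioo (0:ℝ) 1) :
    {x | q ≤ cdf μ x}.Nonempty := by
  obtain ⟨x0, hx0⟩ := ((tendsto_cdf_atTop μ).eventually (lt_mem_nhds hq.2)).exists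
  exact ⟨x0, hx0.le⟩

lemma qf_le_iff (μ : Measure ℝ) [IsProbabilityMeasure μ] {q : ℝ} (hq : q ∈ Set.Ioo (0:ℝ) 1)
    (x : ℝ) : qf μ q ≤ x ↔ q ≤ cdf μ x := by
  rw [qf, if_pos hq]
  constructor
  · intro h
    rw [← (cdf μ).iInf_Ioi_eq x]
    refine le_ciInf fun y => ?_
    obtain ⟨z, hz, hzy⟩ := exists_lt_of_csInf_lt (qf_ne μ hq) (lt_of_le_of_lt h y.2)
    exact le_trans hz (monotone_cdf μ hzy.le)
  · intro h
    exact csInf_le (qf_bdd μ hq) h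

lemma qf_meas (μ : Measure ℝ) [IsProbabilityMeasure μ] : Measurable (qf μ) := by
  refine measurable_of_Iic fun x => ?_
  have : qf μ ⁻¹' Set.Iic x = (Set.Ioo 0 1 ∩ Set.Iic (cdf μ x)) ∪
      ((Set.Ioo 0 1)ᶜ ∩ {_q | (0:ℝ) ≤ x}) := by
    ext q
    by_cases hq : q ∈ Set.Ioo (0:ℝ) 1
    · simp only [Set.mem_preimage, Set.mem_Iic, qf_le_iff μ hq]
      simp [hq.1, hq.2]
    · simp only [Set.mem_preimage, Set.mem_Iic, Set.mem_union, Set.mem_inter_iff, hq,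
        Set.mem_compl_iff, Set.mem_ofPred_eq]
      simp only [qf, if_neg hq]; simp
  rw [this]
  exact (measurableSet_Ioo.inter measurableSet_Iic).union
    (measurableSet_Ioo.compl.inter (MeasurableSet.const _))

noncomputable def unif : Measure ℝ := volume.restrict (Set.Ioo 0 1)

instance : IsProbabilityMeasure unif := ⟨by simp [unif]⟩

lemma qf_map (μ : Measure ℝ) [IsProbabilityMeasure μ] : unif.map (qf μ) = μ := by
  have := Measure.isProbabilityMeasure_map (μ := unif) (qf_meas μ).aemeasurable
  refine Measure.ext_of_Iic _ _ fun x => ?_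
  rw [Measure.map_apply (qf_meas μ) measurableSet_Iic, unif,
    Measure.restrict_apply (qf_meas μ measurableSet_Iic), ← ofReal_cdf μ x]
  have : qf μ ⁻¹' Set.Iic x ∩ Set.Ioo 0 1 = Set.Ioo 0 1 ∩ Set.Iic (cdf μ x) := by
    ext q
    simp only [Set.mem_inter_iff, Set.mem_preimage, Set.mem_Iic]
    rw [and_comm]
    exact and_congr_right fun hq => qf_le_iff μ hq x
  rw [this]
  have h1 := cdf_le_one μ x
  apply le_antisymm
  · calc volume (Set.Ioo 0 1 ∩ Set.Iic (cdf μ x)) ≤ volume (Set.Ioc 0 (cdf μ x)) :=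
          measure_mono (fun q hq => ⟨hq.1.1, hq.2⟩)
      _ = _ := by simp
  · calc _ = volume (Set.Ioo 0 (cdf μ x)) := by simp
      _ ≤ volume (Set.Ioo 0 1 ∩ Set.Iic (cdf μ x)) := measure_mono (fun q hq => ⟨⟨hq.1, lt_of_lt_of_le hq.2 h1⟩, hq.2.le⟩)

lemma qf_mono {μ ν : Measure ℝ} [IsProbabilityMeasure μ] [IsProbabilityMeasure ν]
    (h : FOSD μ ν) (q : ℝ) : qf ν q ≤ qf μ q := by
  by_cases hq : q ∈ Set.Ioo (0:ℝ) 1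
  · rw [qf_le_iff ν hq]
    refine le_trans ((qf_le_iff μ hq _).1 le_rfl) ?_
    rw [cdf_eq_real, cdf_eq_real]
    exact ENNReal.toReal_mono (measure_ne_top _ _) (h _)
  · simp only [qf, if_neg hq]; exact le_rfl

lemma map_update {n : ℕ} (P : Fin n → Measure ℝ) [∀ i, IsProbabilityMeasure (P i)] (i : Fin n) :
    ((Measure.pi P).prod (P i)).map (fun w => Function.update w.1 i w.2) = Measure.pi P := by
  have hm : Measurable (fun w : (Fin n → ℝ) × ℝ => Function.update w.1 i w.2) := by
    rw [measurable_pi_iff]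
    intro j
    by_cases h : j = i
    · subst h; simpa using measurable_snd
    · simp only [Function.update_of_ne h]; fun_prop
  symm
  refine Measure.pi_eq fun s hs => ?_
  rw [Measure.map_apply hm (MeasurableSet.univ_pi hs)]
  have : (fun w : (Fin n → ℝ) × ℝ => Function.update w.1 i w.2) ⁻¹' (Set.univ.pi s)
      = (Set.univ.pi (Function.update s i Set.univ)) ×ˢ (s i) := by
    ext w
    simp only [Set.mem_preimage, Set.mem_pi, Set.mem_univ, true_imp_iff, Set.mem_prod]
    constructor
    · intro h
      refine ⟨fun j => ?_, by simpa using h i⟩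
      by_cases hj : j = i
      · subst hj; simp
      · simpa [hj] using h j
    · rintro ⟨h1, h2⟩ j
      by_cases hj : j = i
      · subst hj; simpa using h2
      · simpa [hj] using h1 j
  rw [this, Measure.prod_prod, Measure.pi_pi]
  rw [← Finset.mul_prod_erase Finset.univ _ (Finset.mem_univ i),
    ← Finset.mul_prod_erase Finset.univ (fun j => P j (s j)) (Finset.mem_univ i)]
  simp only [Function.update_self, measure_univ, one_mul]
  rw [mul_comm]
  congr 1
  refine Finset.prod_congr rfl fun j hj => ?_
  rw [Function.update_of_ne (Finset.ne_of_mem_erase hj)]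

lemma upd_meas {n : ℕ} (i : Fin n) :
    Measurable (fun w : (Fin n → ℝ) × ℝ => Function.update w.1 i w.2) := by
  rw [measurable_pi_iff]
  intro j
  by_cases h : j = i
  · subst h; simpa using measurable_snd
  · simp only [Function.update_of_ne h]; fun_prop

lemma fub {n : ℕ} (P : Fin n → Measure ℝ) [∀ i, IsProbabilityMeasure (P i)] (i : Fin n)
    (G : (Fin n → ℝ) → ℝ) (hG : Integrable G (Measure.pi P)) :
    Integrable (fun u => ∫ y, G (Function.update u i y) ∂(P i)) (Measure.pi P) ∧
    ∫ u, G u ∂(Measure.pi P) = ∫ u, ∫ y, G (Function.update u i y) ∂(P i) ∂(Measure.pi P) := by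
  have hG' := hG
  rw [← map_update P i] at hG
  have h2 : Integrable (fun w : (Fin n → ℝ) × ℝ => G (Function.update w.1 i w.2))
    ((Measure.pi P).prod (P i)) := hG.comp_measurable (upd_meas i)
  refine ⟨h2.integral_prod_left, ?_⟩
  rw [← integral_prod _ h2]
  conv_lhs => rw [← map_update P i]
  rw [integral_map (upd_meas i).aemeasurable hG.aestronglyMeasurable]

lemma fub_mono {n : ℕ} (P : Fin n → Measure ℝ) [∀ i, IsProbabilityMeasure (P i)] (i : Fin n)
    (G H : (Fin n → ℝ) → ℝ) (hG : Integrable G (Measure.pi P)) (hH : Integrable H (Measure.pi P))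
    (h : ∀ᵐ u ∂(Measure.pi P), ∫ y, G (Function.update u i y) ∂(P i) ≤
      ∫ y, H (Function.update u i y) ∂(P i)) :
    ∫ u, G u ∂(Measure.pi P) ≤ ∫ u, H u ∂(Measure.pi P) := by
  rw [(fub P i G hG).2, (fub P i H hH).2]
  exact integral_mono_ae (fub P i G hG).1 (fub P i H hH).1 h


/-- Myerson payment for a discrete allocation sequence. -/
noncomputable def mpay (a X : ℕ → ℝ) (j : ℕ) : ℝ :=
  a j * X j - ∑ l ∈ Finset.range j, (a (l + 1) - a l) * X l

lemma mpay_succ (a X : ℕ → ℝ) (j : ℕ) :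
    mpay a X (j + 1) = mpay a X j + a (j + 1) * (X (j + 1) - X j) := by
  simp only [mpay, Finset.sum_range_succ]; ring

lemma mpay_thr (a : ℕ → ℝ) (m j : ℕ) :
    mpay a (fun l => if m ≤ l then 1 else 0) j = if m ≤ j then a m else 0 := by
  induction j with
  | zero =>
    by_cases h : m = 0
    · subst h; simp [mpay]
    · simp [mpay, h]
  | succ j ih =>
    rw [mpay_succ, ih]
    by_cases h : m ≤ j
    · simp [h, Nat.le_succ_of_le h]
    · by_cases h' : m = j + 1
      · subst h'; simp
      · have : ¬ m ≤ j + 1 := by omega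
        simp [h, this]

lemma mpay_lin (k : ℕ) (a f : ℕ → ℝ) : ∃ c : ℕ → ℝ, ∀ X : ℕ → ℝ,
    ∑ j ∈ Finset.range k, f j * mpay a X j = ∑ j ∈ Finset.range k, c j * X j := by
  refine ⟨fun l => f l * a l - ∑ j ∈ Finset.Ico (l + 1) k, f j * (a (l + 1) - a l), fun X => ?_⟩
  have h : ∑ j ∈ Finset.range k, ∑ l ∈ Finset.range j, f j * ((a (l + 1) - a l) * X l)
      = ∑ l ∈ Finset.range k, ∑ j ∈ Finset.Ico (l + 1) k, f j * ((a (l + 1) - a l) * X l) := by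
    apply Finset.sum_comm'
    intro x y
    simp only [Finset.mem_range, Finset.mem_Ico]
    omega
  simp only [mpay, mul_sub, Finset.mul_sum, Finset.sum_sub_distrib, sub_mul, Finset.sum_mul] at h ⊢
  simp only [← mul_assoc] at h ⊢
  linarith [h]

lemma iron (k : ℕ) (a f : ℕ → ℝ) (hf : ∀ j < k, 0 < f j) :
    ∃ ψ : ℕ → ℝ, (∀ i j, i ≤ j → j < k → ψ i ≤ ψ j) ∧
      (∀ X : ℕ → ℝ, (∀ i j, i ≤ j → j < k → X i ≤ X j) →
        ∑ j ∈ Finset.range k, f j * mpay a X j ≤ ∑ j ∈ Finset.range k, f j * (ψ j * X j)) ∧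
      (∀ m < k, (∀ i < m, ψ i < ψ m) →
        ∑ j ∈ Finset.range k, f j * (if m ≤ j then a m - ψ j else 0) = 0) := by
  obtain ⟨c, hc⟩ := mpay_lin k a f
  obtain ⟨ψ', hmono, hopt⟩ := proj_mono k (fun j => f j) (fun j => c j) (fun j => hf j j.2)
  obtain ⟨ψ, hψ⟩ : ∃ ψ : ℕ → ℝ, ∀ j : Fin k, ψ j = ψ' j :=
    ⟨fun j => if h : j < k then ψ' ⟨j, h⟩ else 0, fun j => by simp⟩
  have hm : ∀ i j, i ≤ j → j < k → ψ i ≤ ψ j := by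
    intro i j hij hj
    have := hmono (show (⟨i, by omega⟩ : Fin k) ≤ ⟨j, hj⟩ from hij)
    rwa [← hψ, ← hψ] at this
  have hopt' : ∀ w : ℕ → ℝ, (∀ i j, i ≤ j → j < k → w i ≤ w j) →
      ∑ j ∈ Finset.range k, (c j - f j * ψ j) * (w j - ψ j) ≤ 0 := by
    intro w hw
    have := hopt (fun j => w j) (fun i j hij => hw i j hij j.2)
    rw [Finset.sum_range]
    simpa only [hψ] using this
  have hA : ∀ X : ℕ → ℝ, (∀ i j, i ≤ j → j < k → X i ≤ X j) →
      ∑ j ∈ Finset.range k, (c j - f j * ψ j) * X j ≤ 0 := by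
    intro X hX
    have := hopt' (fun j => ψ j + X j) (fun i j hij hj => add_le_add (hm i j hij hj) (hX i j hij hj))
    simpa using this
  refine ⟨ψ, hm, ?_, ?_⟩
  · intro X hX
    have := hA X hX
    rw [hc]
    simp only [sub_mul, Finset.sum_sub_distrib, mul_assoc] at this
    linarith
  · intro m hmk hlt
    have h1 := hA (fun l => if m ≤ l then 1 else 0) (fun i j hij hj => by
      split_ifs <;> first | omega | norm_num)
    obtain ⟨ε, hε, hgap⟩ : ∃ ε > 0, ∀ i < m, ψ i ≤ ψ m - ε := by
      rcases Nat.eq_zero_or_pos m with h0 | h0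
      · exact ⟨1, one_pos, fun i hi => by omega⟩
      · refine ⟨ψ m - ψ (m - 1), by linarith [hlt (m - 1) (by omega)], fun i hi => ?_⟩
        have := hm i (m - 1) (by omega) (by omega)
        linarith
    have h2 := hopt' (fun j => ψ j - ε * (if m ≤ j then 1 else 0)) (fun i j hij hj => by
      have h := hm i j hij hj
      split_ifs with h3 h4 h4
      · linarith
      · omega
      · have := hm m j h4 hj
        have := hgap i (by omega)
        linarith
      · linarith)
    have h3 : ∑ j ∈ Finset.range k, (c j - f j * ψ j) * (if m ≤ j then (1:ℝ) else 0) = 0 := by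
      apply le_antisymm h1
      have : ∑ j ∈ Finset.range k, (c j - f j * ψ j) *
          ((ψ j - ε * (if m ≤ j then 1 else 0)) - ψ j) =
          - ε * ∑ j ∈ Finset.range k, (c j - f j * ψ j) * (if m ≤ j then (1:ℝ) else 0) := by
        rw [Finset.mul_sum]
        exact Finset.sum_congr rfl fun j _ => by ring
      rw [this] at h2
      by_contra hneg
      push Not at hneg
      nlinarith
    have h4 := hc (fun l => if m ≤ l then 1 else 0)
    simp only [mpay_thr] at h4
    simp only [sub_mul, Finset.sum_sub_distrib] at h3
    rw [← h4, ← Finset.sum_sub_distrib] at h3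
    refine Eq.trans ?_ h3
    refine Finset.sum_congr rfl fun j _ => ?_
    split_ifs <;> ring

lemma integral_fin (μ : Measure ℝ) [IsProbabilityMeasure μ] (hfin : FiniteSupport μ) :
    ∃ (k : ℕ) (a f : ℕ → ℝ), (∀ i j, i < j → j < k → a i < a j) ∧ (∀ j < k, 0 < f j) ∧
      (∀ j < k, μ {a j} ≠ 0) ∧ 0 < k ∧
      ∀ g : ℝ → ℝ, ∫ v, g v ∂μ = ∑ j ∈ Finset.range k, f j * g (a j) := by
  classical
  obtain ⟨s, hs⟩ := hfin
  set A := s.filter (fun x => μ {x} ≠ 0) with hA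
  have key : ∀ g : ℝ → ℝ, ∫ v, g v ∂μ = ∑ x ∈ A, μ.real {x} * g x := by
    intro g
    have h1 : ∫ v, g v ∂μ = ∫ v in (s : Set ℝ), g v ∂μ := by
      rw [Measure.restrict_eq_self_of_ae_mem]
      exact hs
    rw [h1, setIntegral_finset (hf := IntegrableOn.finset)]
    rw [hA, Finset.sum_filter]
    refine Finset.sum_congr rfl fun x _ => ?_
    by_cases h : μ {x} = 0
    · simp [h, Measure.real]
    · simp [h]
  let e := A.orderEmbOfFin rfl
  have he : ∀ j, e j ∈ A := fun j => A.orderEmbOfFin_mem rfl j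
  refine ⟨A.card, fun j => if h : j < A.card then e ⟨j, h⟩ else 0,
    fun j => if h : j < A.card then μ.real {e ⟨j, h⟩} else 0, ?_, ?_, ?_, ?_, ?_⟩
  · intro i j hij hj
    simp only [hj, hij.trans hj, dite_true]
    exact e.strictMono hij
  · intro j hj
    simp only [hj, dite_true]
    have := (Finset.mem_filter.1 (he ⟨j, hj⟩)).2
    exact ENNReal.toReal_pos this (measure_ne_top _ _)
  · intro j hj
    simp only [hj, dite_true]
    exact (Finset.mem_filter.1 (he ⟨j, hj⟩)).2
  · rw [Finset.card_pos, Finset.nonempty_iff_ne_empty]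
    intro h0
    have := key (fun _ => 1)
    simp [h0] at this
  · intro g
    rw [key, Finset.sum_range]
    simp only [Fin.is_lt, dite_true, Fin.eta]
    conv_lhs => rw [← Finset.image_orderEmbOfFin_univ A rfl]
    rw [Finset.sum_image (fun x _ y _ h => e.injective h)]

structure IsVV (μ : Measure ℝ) (φ : ℝ → ℝ) : Prop where
  mono : Monotone φ
  fin : (Set.range φ).Finite
  ub : ∀ x p : ℝ → ℝ, (∀ v, 0 ≤ v → ∀ v', 0 ≤ v' → v * x v' - p v' ≤ v * x v - p v) →
    (∀ v, 0 ≤ v → 0 ≤ v * x v - p v) → ∫ v, p v ∂μ ≤ ∫ v, φ v * x v ∂μ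
  thr : ∀ C : Set ℝ, IsUpperSet C → (∀ z ∈ C, 0 ≤ z) → φ ⁻¹' C = ∅ ∨
    ∃ t, φ ⁻¹' C = Set.Ici t ∧ φ t ≤ t ∧ ∫ v, (Set.Ici t).indicator (fun v => t - φ v) v ∂μ = 0

lemma exists_vv (μ : Measure ℝ) [IsProbabilityMeasure μ] (hfin : FiniteSupport μ)
    (h0 : μ (Set.Iio 0) = 0) : ∃ φ, IsVV μ φ := by
  obtain ⟨k, a, f, ha, hf, hpos, hk, hint⟩ := integral_fin μ hfin
  obtain ⟨ψ, hm, hA, hB⟩ := iron k a f hf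
  have ha0 : ∀ j < k, 0 ≤ a j := by
    intro j hj
    by_contra h
    refine hpos j hj (measure_mono_null ?_ h0)
    intro x hx
    rw [Set.mem_singleton_iff] at hx
    subst hx
    exact not_le.1 h
  have ha' : ∀ i j, i < k → j < k → (a i ≤ a j ↔ i ≤ j) := by
    intro i j hi hj
    constructor
    · intro h
      by_contra h'
      exact absurd (ha j i (by omega) hi) (not_lt.2 h)
    · intro h
      rcases h.eq_or_lt with h | h
      · rw [h]
      · exact (ha i j h hj).le
  set b := min (ψ 0) (-1) with hb
  have hne : (Finset.range k).Nonempty := ⟨0, by simpa using hk⟩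
  set φ : ℝ → ℝ := fun v => (Finset.range k).sup' hne (fun j => if a j ≤ v then ψ j else b) with hφ
  have hbψ : ∀ j < k, b ≤ ψ j := fun j hj => (min_le_left _ _).trans (hm 0 j (by omega) hj)
  have hφa : ∀ j < k, φ (a j) = ψ j := by
    intro j hj
    apply le_antisymm
    · refine Finset.sup'_le _ _ fun i hi => ?_
      have hi := Finset.mem_range.1 hi
      split_ifs with h
      · exact hm i j ((ha' i j hi hj).1 h) hj
      · exact hbψ j hj
    · refine Finset.le_sup'_of_le _ (Finset.mem_range.2 hj) ?_
      simp
  refine ⟨φ, ?_, ?_, ?_, ?_⟩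
  · intro v w hvw
    refine Finset.sup'_le _ _ fun i hi => ?_
    refine Finset.le_sup'_of_le _ hi ?_
    have := hbψ i (Finset.mem_range.1 hi)
    split_ifs with h1 h2
    · exact le_rfl
    · exact absurd (h1.trans hvw) h2
    · exact this
    · exact le_rfl
  · refine ((insert b ((Finset.range k).image ψ)).finite_toSet).subset ?_
    rintro _ ⟨v, rfl⟩
    obtain ⟨i, hi, h⟩ := Finset.exists_mem_eq_sup' hne (fun j => if a j ≤ v then ψ j else b)
    simp only [hφ, h]
    split_ifs
    · simp only [Finset.coe_insert, Finset.coe_image]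
      exact Or.inr ⟨i, hi, rfl⟩
    · simp
  · intro x p hic hir
    rw [hint, hint]
    have hp : ∀ j < k, p (a j) ≤ mpay a (fun j => x (a j)) j := by
      intro j
      induction j with
      | zero =>
        intro h
        have := hir (a 0) (ha0 0 h)
        simp only [mpay, Finset.range_zero, Finset.sum_empty]
        linarith
      | succ j ih =>
        intro h
        have h1 := ih (by omega)
        have h2 := hic (a (j+1)) (ha0 _ h) (a j) (ha0 _ (by omega))
        rw [mpay_succ]
        linarith
    calc _ ≤ ∑ j ∈ Finset.range k, f j * mpay a (fun j => x (a j)) j := by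
          refine Finset.sum_le_sum fun j hj => ?_
          have hj := Finset.mem_range.1 hj
          exact mul_le_mul_of_nonneg_left (hp j hj) (hf j hj).le
      _ ≤ ∑ j ∈ Finset.range k, f j * (ψ j * x (a j)) := by
          refine hA (fun j => x (a j)) fun i j hij hj => ?_
          rcases hij.eq_or_lt with h | h
          · rw [h]
          have h1 := ha i j h hj
          have h2 := hic (a i) (ha0 _ (by omega)) (a j) (ha0 _ hj)
          have h3 := hic (a j) (ha0 _ hj) (a i) (ha0 _ (by omega))
          by_contra h4
          push Not at h4
          nlinarith
      _ = _ := Finset.sum_congr rfl fun j hj => by rw [hφa j (Finset.mem_range.1 hj)]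
  · intro C hC hC0
    have hmem : ∀ v, φ v ∈ C ↔ ∃ j < k, a j ≤ v ∧ ψ j ∈ C := by
      intro v
      constructor
      · intro h
        obtain ⟨i, hi, h'⟩ := Finset.exists_mem_eq_sup' hne (fun j => if a j ≤ v then ψ j else b)
        simp only [hφ, h'] at h
        refine ⟨i, Finset.mem_range.1 hi, ?_⟩
        split_ifs at h with h1
        · exact ⟨h1, h⟩
        · have := hC0 b h
          have := min_le_right (ψ 0) (-1)
          linarith
      · rintro ⟨j, hj, h1, h2⟩
        refine hC ?_ h2
        refine Finset.le_sup'_of_le _ (Finset.mem_range.2 hj) ?_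
        simp [h1]
    by_cases hex : ∃ j, j < k ∧ ψ j ∈ C
    · right
      classical
      set m := Nat.find hex with hmdef
      obtain ⟨hmk, hmC⟩ := Nat.find_spec hex
      rw [← hmdef] at hmk hmC
      have hmin : ∀ j < m, ψ j ∉ C := fun j hj h =>
        Nat.find_min hex hj ⟨by omega, h⟩
      have hz := hB m hmk (fun i hi => by
        by_contra h
        exact hmin i hi (hC (not_lt.1 h) hmC))
      refine ⟨a m, ?_, ?_, ?_⟩
      · ext v
        rw [Set.mem_preimage, hmem, Set.mem_Ici]
        constructor
        · rintro ⟨j, hj, h1, h2⟩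
          refine le_trans ((ha' m j hmk hj).2 ?_) h1
          by_contra h
          exact hmin j (by omega) h2
        · intro h
          exact ⟨m, hmk, h, hmC⟩
      · rw [hφa m hmk]
        by_contra hlt
        push Not at hlt
        have : ∑ j ∈ Finset.range k, f j * (if m ≤ j then a m - ψ j else 0) < 0 := by
          refine Finset.sum_neg' (fun j hj => ?_) ⟨m, Finset.mem_range.2 hmk, ?_⟩
          · have hj := Finset.mem_range.1 hj
            have := hf j hj
            split_ifs with h
            · have := hm m j h hj
              nlinarith
            · simp
          · have := hf m hmk
            simp only [le_refl, if_true]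
            nlinarith
        linarith
      · rw [hint, ← hz]
        refine Finset.sum_congr rfl fun j hj => ?_
        have hj := Finset.mem_range.1 hj
        simp only [Set.indicator_apply, Set.mem_Ici, ha' m j hmk hj, hφa j hj]
    · left
      ext v
      simp only [Set.mem_preimage, hmem, Set.mem_empty_iff_false, iff_false]
      rintro ⟨j, hj, _, h⟩
      exact hex ⟨j, hj, h⟩


/-- Positive part of the maximum. -/
noncomputable def mx {n : ℕ} (z : Fin n → ℝ) : ℝ := Finset.univ.fold max 0 z

lemma mx_le {n : ℕ} {z : Fin n → ℝ} {c : ℝ} : mx z ≤ c ↔ 0 ≤ c ∧ ∀ k, z k ≤ c := by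
  simp [mx, Finset.fold_max_le]

lemma mx_nonneg {n : ℕ} (z : Fin n → ℝ) : 0 ≤ mx z := (mx_le.1 le_rfl).1

lemma le_mx {n : ℕ} (z : Fin n → ℝ) (k : Fin n) : z k ≤ mx z := (mx_le.1 le_rfl).2 k

lemma mx_mono {n : ℕ} {z w : Fin n → ℝ} (h : ∀ k, z k ≤ w k) : mx z ≤ mx w :=
  mx_le.2 ⟨mx_nonneg w, fun k => (h k).trans (le_mx w k)⟩

/-- Winning set of virtual values for buyer `i`. -/
def WS {n : ℕ} (i : Fin n) (z : Fin n → ℝ) : Set ℝ :=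
  {r | 0 ≤ r ∧ (∀ k, k < i → z k < r) ∧ ∀ k, i < k → z k ≤ r}

lemma WS_upper {n : ℕ} (i : Fin n) (z : Fin n → ℝ) : IsUpperSet (WS i z) := by
  intro a b hab ha
  exact ⟨ha.1.trans hab, fun k hk => (ha.2.1 k hk).trans_le hab,
    fun k hk => (ha.2.2 k hk).trans hab⟩

lemma WS_update {n : ℕ} (i : Fin n) (z : Fin n → ℝ) (r : ℝ) :
    WS i (Function.update z i r) = WS i z := by
  ext s
  constructor
  · rintro ⟨h1, h2, h3⟩
    exact ⟨h1, fun k hk => by simpa [hk.ne] using h2 k hk,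
      fun k hk => by simpa [hk.ne'] using h3 k hk⟩
  · rintro ⟨h1, h2, h3⟩
    exact ⟨h1, fun k hk => by simpa [hk.ne] using h2 k hk,
      fun k hk => by simpa [hk.ne'] using h3 k hk⟩

lemma mx_of_mem {n : ℕ} (i : Fin n) (z : Fin n → ℝ) (r : ℝ) (h : r ∈ WS i z) :
    mx (Function.update z i r) ≤ r := by
  refine mx_le.2 ⟨h.1, fun k => ?_⟩
  rcases lt_trichotomy k i with hk | hk | hk
  · simpa [hk.ne] using (h.2.1 k hk).le
  · subst hk; simp
  · simpa [hk.ne'] using h.2.2 k hk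

lemma WS_unique {n : ℕ} {z : Fin n → ℝ} {i j : Fin n} (hi : z i ∈ WS i z) (hj : z j ∈ WS j z) :
    i = j := by
  rcases lt_trichotomy i j with h | h | h
  · exact absurd (hi.2.2 j h) (not_le.2 (hj.2.1 i h))
  · exact h
  · exact absurd (hj.2.2 i h) (not_le.2 (hi.2.1 j h))

lemma exists_win {n : ℕ} (z : Fin n → ℝ) (h : 0 < mx z) : ∃ i, z i ∈ WS i z := by
  classical
  have h1 : ∃ k, 0 < z k := by
    by_contra hc
    push Not at hc
    exact absurd (mx_le.2 ⟨le_rfl, hc⟩) (not_le.2 h)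
  obtain ⟨k0, hk0⟩ := h1
  obtain ⟨m, -, hm⟩ := Finset.exists_max_image Finset.univ z ⟨k0, Finset.mem_univ _⟩
  have hne : (Finset.univ.filter (fun k => z k = z m)).Nonempty := ⟨m, by simp⟩
  refine ⟨(Finset.univ.filter (fun k => z k = z m)).min' hne, ?_⟩
  have hi := Finset.min'_mem _ hne
  have hlt : ∀ k, k < (Finset.univ.filter (fun k => z k = z m)).min' hne → z k ≠ z m := by
    intro k hk h
    exact absurd (Finset.min'_le _ k (by simp [h])) (not_le.2 hk)
  generalize (Finset.univ.filter (fun k => z k = z m)).min' hne = i at *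
  simp only [Finset.mem_filter, Finset.mem_univ, true_and] at hi
  rw [hi]
  exact ⟨hk0.le.trans (hm k0 (Finset.mem_univ _)),
    fun k hk => lt_of_le_of_ne (hm k (Finset.mem_univ _)) (hlt k hk),
    fun k _ => hm k (Finset.mem_univ _)⟩

def FV {n : ℕ} (φ : Fin n → ℝ → ℝ) (v : Fin n → ℝ) : Fin n → ℝ := fun k => φ k (v k)

lemma FV_update {n : ℕ} (φ : Fin n → ℝ → ℝ) (v : Fin n → ℝ) (i : Fin n) (y : ℝ) :
    FV φ (Function.update v i y) = Function.update (FV φ v) i (φ i y) := by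
  ext k
  by_cases h : k = i
  · subst h; simp [FV]
  · simp [FV, h]

open Classical in
noncomputable def mech {n : ℕ} (φ : Fin n → ℝ → ℝ) : Mech n where
  alloc v i := if FV φ v i ∈ WS i (FV φ v) then 1 else 0
  pay v i := if FV φ v i ∈ WS i (FV φ v) then sInf (φ i ⁻¹' WS i (FV φ v)) else 0

lemma fin_meas {Ω E : Type*} [MeasurableSpace Ω] [MeasurableSpace E] [MeasurableSingletonClass E]
    (F : Ω → E) (hF : Measurable F) (hfin : (Set.range F).Finite) (g : E → ℝ) :
    Measurable (fun w => g (F w)) ∧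
      ∀ (μ : Measure Ω) [IsFiniteMeasure μ], Integrable (fun w => g (F w)) μ := by
  let S : SimpleFunc Ω E := ⟨F, fun x => hF (measurableSet_singleton x), hfin⟩
  exact ⟨(S.map g).measurable, fun μ _ => (S.map g).integrable_of_isFiniteMeasure⟩

lemma FV_meas {n : ℕ} {φ : Fin n → ℝ → ℝ} (h : ∀ i, Monotone (φ i)) : Measurable (FV φ) := by
  rw [measurable_pi_iff]
  intro i
  exact (h i).measurable.comp (measurable_pi_apply i)

lemma FV_fin {n : ℕ} {φ : Fin n → ℝ → ℝ} (h : ∀ i, (Set.range (φ i)).Finite) :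
    (Set.range (FV φ)).Finite := by
  refine (Set.Finite.pi (fun i => h i)).subset ?_
  rintro _ ⟨v, rfl⟩ i _
  exact ⟨v i, rfl⟩

lemma mech_good {n : ℕ} (μ : Fin n → Measure ℝ) (φ : Fin n → ℝ → ℝ)
    (h : ∀ i, IsVV (μ i) (φ i)) : (mech φ).Good := by
  classical
  have hF := FV_meas (fun i => (h i).mono)
  have hf := FV_fin (fun i => (h i).fin)
  refine ⟨fun v => ⟨fun i => ?_, ?_⟩, fun i v hv v' hv' => ?_, fun v hv i => ?_,
    fun i => ?_, fun i => ?_⟩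
  · simp only [mech]; split_ifs <;> norm_num
  · simp only [mech]
    by_cases hw : ∃ i, FV φ v i ∈ WS i (FV φ v)
    · obtain ⟨i, hi⟩ := hw
      rw [Finset.sum_eq_single i]
      · simp [hi]
      · intro j _ hj
        rw [if_neg]
        intro hj'
        exact hj (WS_unique hj' hi)
      · simp
    · push Not at hw
      simp [hw]
  · simp only [mech, FV_update, WS_update, Function.update_self]
    rcases (h i).thr (WS i (FV φ v)) (WS_upper _ _) (fun z hz => hz.1) with he | ⟨t, ht, -, -⟩
    · have hn : ∀ y, φ i y ∉ WS i (FV φ v) := fun y hy => by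
        have : y ∈ φ i ⁻¹' WS i (FV φ v) := hy
        rw [he] at this
        exact this
      have hn' : FV φ v i ∉ WS i (FV φ v) := hn (v i)
      simp [hn, hn']
    · have hn : ∀ y, φ i y ∈ WS i (FV φ v) ↔ t ≤ y := fun y => by
        rw [← Set.mem_preimage, ht]; rfl
      have hn' : FV φ v i ∈ WS i (FV φ v) ↔ t ≤ v i := hn (v i)
      rw [ht, csInf_Ici]
      simp only [hn, hn']
      split_ifs <;> linarith
  · simp only [mech]
    rcases (h i).thr (WS i (FV φ v)) (WS_upper _ _) (fun z hz => hz.1) with he | ⟨t, ht, -, -⟩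
    · have hn' : FV φ v i ∉ WS i (FV φ v) := fun hy => by
        have : v i ∈ φ i ⁻¹' WS i (FV φ v) := hy
        rw [he] at this
        exact this
      simp [hn']
    · have hn' : FV φ v i ∈ WS i (FV φ v) ↔ t ≤ v i := by
        change v i ∈ φ i ⁻¹' WS i (FV φ v) ↔ _
        rw [ht]; rfl
      rw [ht, csInf_Ici]
      simp only [hn']
      split_ifs <;> linarith
  · exact (fin_meas (FV φ) hF hf (fun z => if z i ∈ WS i z then 1 else 0)).1
  · exact (fin_meas (FV φ) hF hf (fun z => if z i ∈ WS i z then sInf (φ i ⁻¹' WS i z) else 0)).1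

lemma upper {n : ℕ} (D : Fin n → Measure ℝ) [∀ i, IsProbabilityMeasure (D i)]
    (hfin : ∀ i, FiniteSupport (D i)) (h0 : ∀ i, D i (Set.Iio 0) = 0)
    (φ : Fin n → ℝ → ℝ) (h : ∀ i, IsVV (D i) (φ i)) (M : Mech n) (hM : M.Good) :
    Rev M (Measure.pi D) ≤ ∫ v, mx (FV φ v) ∂(Measure.pi D) := by
  choose s hs using hfin
  have hae : ∀ᵐ v ∂(Measure.pi D), ∀ i, v i ∈ s i ∧ 0 ≤ v i := by
    rw [ae_all_iff]
    intro i
    have h1 : ∀ᵐ y ∂(D i), y ∈ s i ∧ 0 ≤ y := by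
      have h2 : ∀ᵐ y ∂(D i), y ∈ (s i : Set ℝ) := hs i
      have h3 : ∀ᵐ y ∂(D i), y ∈ (Set.Iio (0:ℝ))ᶜ :=
        compl_mem_ae_iff.2 (h0 i)
      filter_upwards [h2, h3] with y hy hy'
      exact ⟨hy, by simpa using hy'⟩
    exact (measurePreserving_eval D i).quasiMeasurePreserving.ae h1
  have hI : ∀ g : (Fin n → ℝ) → ℝ, Integrable g (Measure.pi D) := by
    intro g
    have h1 : IntegrableOn g (Set.univ.pi (fun i => (s i : Set ℝ))) (Measure.pi D) :=
      IntegrableOn.of_finite (Set.Finite.pi (fun i => (s i).finite_toSet))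
    rw [IntegrableOn, Measure.restrict_eq_self_of_ae_mem] at h1
    · exact h1
    · filter_upwards [hae] with v hv i _
      exact (hv i).1
  obtain ⟨hval, hic, hir, -⟩ := hM
  have step : ∀ i, ∫ v, M.pay v i ∂(Measure.pi D) ≤
      ∫ v, φ i (v i) * M.alloc v i ∂(Measure.pi D) := by
    intro i
    refine fub_mono D i _ _ (hI _) (hI _) ?_
    filter_upwards [hae] with u hu
    have hnn : ∀ y, 0 ≤ y → ∀ j, 0 ≤ Function.update u i y j := by
      intro y hy j
      by_cases hj : j = i
      · subst hj; simpa using hy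
      · simpa [hj] using (hu j).2
    have := (h i).ub (fun y => M.alloc (Function.update u i y) i)
      (fun y => M.pay (Function.update u i y) i) (fun y hy y' hy' => by
        simpa using hic i (Function.update u i y) (hnn y hy) y' hy') (fun y hy => by
        simpa using hir (Function.update u i y) (hnn y hy) i)
    simpa using this
  calc Rev M (Measure.pi D) = ∑ i, ∫ v, M.pay v i ∂(Measure.pi D) :=
        integral_finsetSum _ (fun i _ => hI _)
    _ ≤ ∑ i, ∫ v, φ i (v i) * M.alloc v i ∂(Measure.pi D) :=
        Finset.sum_le_sum fun i _ => step i
    _ = ∫ v, ∑ i, φ i (v i) * M.alloc v i ∂(Measure.pi D) :=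
        (integral_finsetSum _ (fun i _ => hI _)).symm
    _ ≤ _ := by
        refine integral_mono (hI _) (hI _) fun v => ?_
        calc ∑ i, φ i (v i) * M.alloc v i ≤ ∑ i, mx (FV φ v) * M.alloc v i :=
              Finset.sum_le_sum fun i _ =>
                mul_le_mul_of_nonneg_right (le_mx (FV φ v) i) ((hval v).1 i).1
          _ = mx (FV φ v) * ∑ i, M.alloc v i := by rw [Finset.mul_sum]
          _ ≤ mx (FV φ v) * 1 := mul_le_mul_of_nonneg_left (hval v).2 (mx_nonneg _)
          _ = _ := mul_one _

lemma lower {n : ℕ} (D D₀ : Fin n → Measure ℝ) [∀ i, IsProbabilityMeasure (D i)]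
    [∀ i, IsProbabilityMeasure (D₀ i)] (hd : ∀ i, FOSD (D i) (D₀ i))
    (φ : Fin n → ℝ → ℝ) (h : ∀ i, IsVV (D₀ i) (φ i)) :
    ∫ v, mx (FV φ v) ∂(Measure.pi D₀) ≤ Rev (mech φ) (Measure.pi D) := by
  classical
  have hF := FV_meas (fun i => (h i).mono)
  have hf := FV_fin (fun i => (h i).fin)
  let V : (Fin n → Measure ℝ) → (Fin n → ℝ) → (Fin n → ℝ) := fun D u k => qf (D k) (u k)
  let π : Measure (Fin n → ℝ) := Measure.pi (fun _ => unif)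
  have hVm : ∀ (D : Fin n → Measure ℝ) [∀ i, IsProbabilityMeasure (D i)], Measurable (V D) := by
    intro D _
    rw [measurable_pi_iff]
    intro i
    exact (qf_meas (D i)).comp (measurable_pi_apply i)
  have hV : ∀ (D : Fin n → Measure ℝ) [∀ i, IsProbabilityMeasure (D i)],
      Measure.pi D = π.map (V D) := by
    intro D _
    have := fun i => Measure.isProbabilityMeasure_map (μ := unif) (qf_meas (D i)).aemeasurable
    have h1 := Measure.pi_map_pi (μ := fun _ : Fin n => unif) (f := fun i => qf (D i))
      (fun i => (qf_meas (D i)).aemeasurable)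
    simp only [qf_map] at h1
    exact h1.symm
  let F2 : (Fin n → ℝ) → (Fin n → ℝ) × (Fin n → ℝ) := fun u => (FV φ (V D u), FV φ (V D₀ u))
  have hF2 : Measurable F2 := (hF.comp (hVm D)).prodMk (hF.comp (hVm D₀))
  have hf2 : (Set.range F2).Finite := by
    refine (hf.prod hf).subset ?_
    rintro _ ⟨u, rfl⟩
    exact ⟨⟨_, rfl⟩, ⟨_, rfl⟩⟩
  have hI := fun g => (fin_meas F2 hF2 hf2 g).2 π
  have hle : ∀ u k, FV φ (V D₀ u) k ≤ FV φ (V D u) k := fun u k =>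
    (h k).mono (qf_mono (hd k) (u k))
  let T : Fin n → (Fin n → ℝ) × (Fin n → ℝ) → ℝ := fun i z =>
    if z.1 i ∈ WS i z.1 then mx (Function.update z.1 i (z.2 i)) else 0
  let P : Fin n → (Fin n → ℝ) × (Fin n → ℝ) → ℝ := fun i z =>
    if z.1 i ∈ WS i z.1 then sInf (φ i ⁻¹' WS i z.1) else 0
  have step : ∀ i, ∫ u, T i (F2 u) ∂π ≤ ∫ u, P i (F2 u) ∂π := by
    intro i
    refine fub_mono (fun _ => unif) i _ _ (hI (T i)) (hI (P i)) (Filter.Eventually.of_forall ?_)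
    intro u
    have hVu : ∀ (D : Fin n → Measure ℝ) y, V D (Function.update u i y)
        = Function.update (V D u) i (qf (D i) y) := by
      intro D y
      ext k
      by_cases hk : k = i
      · subst hk; simp [V]
      · simp [V, hk]
    simp only [T, P, F2, hVu, FV_update, WS_update, Function.update_self,
      Function.update_idem]
    generalize hz : FV φ (V D u) = z
    let G : ℝ → ℝ × ℝ := fun y => (φ i (qf (D i) y), φ i (qf (D₀ i) y))
    have hG : Measurable G := ((h i).mono.measurable.comp (qf_meas _)).prodMk
      ((h i).mono.measurable.comp (qf_meas _))
    have hGf : (Set.range G).Finite := by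
      refine ((h i).fin.prod (h i).fin).subset ?_
      rintro _ ⟨u, rfl⟩
      exact ⟨⟨_, rfl⟩, ⟨_, rfl⟩⟩
    have hGI := fun g => (fin_meas G hG hGf g).2 unif
    have hI1 := hGI (fun w => if w.1 ∈ WS i z then mx (Function.update z i w.2) else 0)
    have hI2 := hGI (fun w => if w.1 ∈ WS i z then sInf (φ i ⁻¹' WS i z) else 0)
    rcases (h i).thr (WS i z) (WS_upper _ _) (fun z hz => hz.1) with he | ⟨t, ht, htt, hint⟩
    · have hn : ∀ y, φ i y ∉ WS i z := fun y hy => by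
        have : y ∈ φ i ⁻¹' WS i z := hy
        rw [he] at this
        exact this
      simp [hn]
    · have hn : ∀ y, φ i y ∈ WS i z ↔ t ≤ y := fun y => by
        rw [← Set.mem_preimage, ht]; rfl
      rw [← sub_nonneg, ← integral_sub hI2 hI1]
      have hm : Measurable (fun v => (Set.Ici t).indicator (fun v => t - φ i v) v) :=
        (measurable_const.sub (h i).mono.measurable).indicator measurableSet_Ici
      rw [← qf_map (D₀ i), integral_map (qf_meas _).aemeasurable hm.aestronglyMeasurable] at hint
      refine hint.symm.le.trans ?_
      refine integral_mono ?_ (hI2.sub hI1) ?_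
      · have := hGI (fun w => if w.2 ∈ WS i z then t - w.2 else 0)
        refine this.congr (Filter.Eventually.of_forall fun y => ?_)
        simp only [G, hn, Set.indicator_apply, Set.mem_Ici]
      · intro y
        have hq := qf_mono (hd i) y
        simp only [G, hn, ht, csInf_Ici, Set.indicator_apply, Set.mem_Ici]
        by_cases h1 : t ≤ qf (D₀ i) y
        · have h2 := mx_of_mem i z _ ((hn _).2 h1)
          rw [if_pos h1, if_pos (h1.trans hq), if_pos (h1.trans hq)]
          linarith
        · rw [if_neg h1]
          split_ifs with h2
          · have h3 := mx_of_mem i z _ ((hn t).2 le_rfl)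
            have h4 : mx (Function.update z i (φ i (qf (D₀ i) y))) ≤
                mx (Function.update z i (φ i t)) := by
              refine mx_mono fun k => ?_
              by_cases hk : k = i
              · subst hk; simpa using (h k).mono (not_le.1 h1).le
              · simp [hk]
            linarith
          · simp
  have hpt : ∀ u, mx (FV φ (V D₀ u)) ≤ ∑ i, T i (F2 u) := by
    intro u
    have hT0 : ∀ i, 0 ≤ T i (F2 u) := by
      intro i
      simp only [T]
      split_ifs
      · exact mx_nonneg _
      · exact le_rfl
    rcases (mx_nonneg (FV φ (V D₀ u))).eq_or_lt with h0 | h0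
    · rw [← h0]
      exact Finset.sum_nonneg fun i _ => hT0 i
    · obtain ⟨i, hi⟩ := exists_win (FV φ (V D u)) (h0.trans_le (mx_mono (hle u)))
      refine le_trans ?_ (Finset.single_le_sum (fun i _ => hT0 i) (Finset.mem_univ i))
      simp only [T, F2, if_pos hi]
      refine mx_mono fun k => ?_
      by_cases hk : k = i
      · subst hk; simp
      · simpa [hk] using hle u k
  have e1 : ∫ v, mx (FV φ v) ∂(Measure.pi D₀) = ∫ u, mx (FV φ (V D₀ u)) ∂π := by
    rw [hV D₀, integral_map (hVm D₀).aemeasurable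
      (fin_meas (FV φ) hF hf mx).1.aestronglyMeasurable]
  have e2 : Rev (mech φ) (Measure.pi D) = ∫ u, ∑ i, P i (F2 u) ∂π := by
    have hm := (fin_meas (FV φ) hF hf
      (fun z => ∑ i, if z i ∈ WS i z then sInf (φ i ⁻¹' WS i z) else 0)).1
    have := integral_map (μ := π) (hVm D).aemeasurable hm.aestronglyMeasurable
    rw [← hV D] at this
    exact this
  rw [e1, e2]
  calc _ ≤ ∫ u, ∑ i, T i (F2 u) ∂π :=
        integral_mono (hI (fun z => mx z.2)) (hI (fun z => ∑ i, T i z)) hpt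
    _ = ∑ i, ∫ u, T i (F2 u) ∂π := integral_finsetSum _ fun i _ => hI (T i)
    _ ≤ ∑ i, ∫ u, P i (F2 u) ∂π := Finset.sum_le_sum fun i _ => step i
    _ = _ := (integral_finsetSum _ fun i _ => hI (P i)).symm

end RevMon

/-- **Revenue monotonicity.** For a finitely supported product distribution `D₀`
on `[0,∞)ⁿ` there is an optimal measurable DSIC and IR mechanism `M₀` whose
revenue can only increase when run on any finitely supported product
distribution `D ⪰ D₀` (component-wise first-order stochastic dominance). -/
theorem revenue_monotonicity {n : ℕ} (hn : 1 ≤ n) (D₀ : Fin n → Measure ℝ)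
    (h₀prob : ∀ i, IsProbabilityMeasure (D₀ i))
    (h₀fin : ∀ i, FiniteSupport (D₀ i))
    (h₀nonneg : ∀ i, D₀ i (Set.Iio 0) = 0) :
    ∃ M₀ : Mech n, M₀.Good ∧ Rev M₀ (Measure.pi D₀) = Opt (Measure.pi D₀) ∧
      ∀ D : Fin n → Measure ℝ, (∀ i, IsProbabilityMeasure (D i)) →
        (∀ i, FiniteSupport (D i)) → (∀ i, D i (Set.Iio 0) = 0) →
        (∀ i, FOSD (D i) (D₀ i)) →
        Rev M₀ (Measure.pi D₀) ≤ Rev M₀ (Measure.pi D) := by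
  choose φ hφ using fun i => RevMon.exists_vv (D₀ i) (h₀fin i) (h₀nonneg i)
  have hup := RevMon.upper D₀ h₀fin h₀nonneg φ hφ
  have hgood := RevMon.mech_good D₀ φ hφ
  have hself := RevMon.lower D₀ D₀ (fun i t => le_rfl) φ hφ
  refine ⟨RevMon.mech φ, hgood, ?_, ?_⟩
  · have hg : IsGreatest {r : ℝ | ∃ M : Mech n, M.Good ∧ r = Rev M (Measure.pi D₀)}
        (Rev (RevMon.mech φ) (Measure.pi D₀)) := by
      refine ⟨⟨_, hgood, rfl⟩, ?_⟩
      rintro _ ⟨M, hM, rfl⟩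
      exact (hup M hM).trans hself
    exact hg.csSup_eq.symm
  · intro D hD _ _ hd
    exact (hup _ hgood).trans (RevMon.lower D D₀ hd φ hφ)
end

section
/- Fix a finite set V ⊂ [0,∞) and n ≥ 1. Let D₀ be a product probability distribution on Vⁿ, let 𝒟 be the set of all product probability distributions D on Vⁿ with D ⪰ D₀ component-wise, let 𝔇 be the convex hull of 𝒟 inside the set of probability distributions on Vⁿ, and let g(D) = sup_{M∈ℳ} Rev(M,D) where ℳ is the set of DSIC and IR mechanisms on Vⁿ. Then D₀ minimizes g over 𝔇: for every D ∈ 𝔇, g(D) ≥ g(D₀). -/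
open MeasureTheory

/-- Allocation probabilities are in `[0,1]` and sum to at most `1` on `Vⁿ`. -/
def Mech.ValidOn {n : ℕ} (V : Finset ℝ) (M : Mech n) : Prop :=
  ∀ v : Fin n → ℝ, (∀ j, v j ∈ V) →
    (∀ i, 0 ≤ M.alloc v i ∧ M.alloc v i ≤ 1) ∧ ∑ i, M.alloc v i ≤ 1

/-- Dominant strategy incentive compatibility on `Vⁿ`. -/
def Mech.DSICOn {n : ℕ} (V : Finset ℝ) (M : Mech n) : Prop :=
  ∀ (i : Fin n) (v : Fin n → ℝ), (∀ j, v j ∈ V) → ∀ v' ∈ V,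
    v i * M.alloc (Function.update v i v') i - M.pay (Function.update v i v') i ≤
      v i * M.alloc v i - M.pay v i

/-- Individual rationality on `Vⁿ`. -/
def Mech.IROn {n : ℕ} (V : Finset ℝ) (M : Mech n) : Prop :=
  ∀ v : Fin n → ℝ, (∀ j, v j ∈ V) → ∀ i, 0 ≤ v i * M.alloc v i - M.pay v i

/-- A probability mass function on the finite set `V ⊆ ℝ`. -/
def IsDist1 (V : Finset ℝ) (d : ℝ → ℝ) : Prop :=
  (∀ x, 0 ≤ d x) ∧ (∀ x, x ∉ V → d x = 0) ∧ ∑ x ∈ V, d x = 1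

/-- First-order stochastic dominance `d ⪰ d'` for pmfs on `V`. -/
def Dominates1 (V : Finset ℝ) (d d' : ℝ → ℝ) : Prop :=
  ∀ t : ℝ, ∑ x ∈ V.filter (fun x => x ≤ t), d x ≤ ∑ x ∈ V.filter (fun x => x ≤ t), d' x

/-- Expected revenue of `M` under a pmf `d` on `Vⁿ`. -/
noncomputable def RevF {n : ℕ} (V : Finset ℝ) (M : Mech n) (d : (Fin n → ℝ) → ℝ) : ℝ :=
  ∑ v ∈ Fintype.piFinset (fun _ : Fin n => V), d v * ∑ i, M.pay v i

/-- The set of product pmfs on `Vⁿ` component-wise dominating `d₀`. -/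
def ProdDoms {n : ℕ} (V : Finset ℝ) (d₀ : Fin n → ℝ → ℝ) : Set ((Fin n → ℝ) → ℝ) :=
  {d | ∃ marg : Fin n → ℝ → ℝ, (∀ i, IsDist1 V (marg i)) ∧
    (∀ i, Dominates1 V (marg i) (d₀ i)) ∧ d = fun v => ∏ i, marg i (v i)}

/-- The set of DSIC and IR mechanisms on `Vⁿ`. -/
def Mechs (n : ℕ) (V : Finset ℝ) : Set (Mech n) :=
  {M | M.ValidOn V ∧ M.DSICOn V ∧ M.IROn V}


/-- Optimal revenue over DSIC and IR mechanisms on `Vⁿ` for a pmf `d`. -/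
noncomputable def gOpt (n : ℕ) (V : Finset ℝ) (d : (Fin n → ℝ) → ℝ) : ℝ :=
  ⨆ M : (Mechs n V), RevF V M.1 d


lemma quad_aux {r g P : ℝ} (hr : 0 < r) (hP : 0 < P)
    (h : ∀ e, 0 ≤ e → e ≤ r → 0 ≤ e * g + e ^ 2 / 2 * P) : 0 ≤ g := by
  by_contra hg
  push Not at hg
  have h1 : 0 < -g / P := div_pos (by linarith) hP
  have h2 : 0 < min r (-g / P) := lt_min hr h1
  have h3 := h _ h2.le (min_le_left _ _)
  set e := min r (-g / P)
  have h4 : e ≤ -g / P := min_le_right _ _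
  rw [le_div_iff₀ hP] at h4
  have : e * g + e ^ 2 / 2 * P = e * (g + e * P / 2) := by ring
  rw [this] at h3
  have := mul_neg_of_pos_of_neg h2 (show g + e * P / 2 < 0 by linarith)
  linarith

lemma ironed (V : Finset ℝ) (d : ℝ → ℝ) (hd : IsDist1 V d) :
    ∃ w : ℝ → ℝ, Monotone w ∧ (∀ v, 0 ≤ w v) ∧
      (∀ θ ∈ V, θ * ∑ v ∈ V with θ ≤ v, d v ≤ ∑ v ∈ V with θ ≤ v, d v * w v) ∧
      (∀ θ ∈ V, 0 < w θ → (∀ θ' ∈ V, θ' < θ → w θ' < w θ) →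
        θ * ∑ v ∈ V with θ ≤ v, d v = ∑ v ∈ V with θ ≤ v, d v * w v ∧ w θ ≤ θ) := by
  obtain ⟨hd0, hdV, hd1⟩ := hd
  obtain ⟨B, hB0, hB⟩ : ∃ B : ℝ, 0 < B ∧ ∀ θ ∈ V, θ < B := by
    obtain ⟨b, hb⟩ := V.bddAbove
    refine ⟨max b 0 + 1, by positivity, fun θ hθ => ?_⟩
    have := hb (Finset.mem_coe.2 hθ)
    have := le_max_left b 0
    linarith
  set P : ℝ → ℝ := fun θ => ∑ v ∈ V with θ ≤ v, d v with hP
  have hP0 : ∀ θ, 0 ≤ P θ := fun θ => Finset.sum_nonneg fun v _ => hd0 v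
  set T : Finset ℝ := V.filter fun θ => 0 < P θ with hT
  set W : (ℝ → ℝ) → ℝ → ℝ := fun l v => ∑ θ ∈ T with θ ≤ v, l θ with hW
  set F : (ℝ → ℝ) → ℝ := fun l => ∑ v ∈ V, d v * (W l v) ^ 2 / 2 - ∑ θ ∈ T, l θ * (θ * P θ)
    with hF
  have hcont : Continuous F := by
    simp only [hF, hW]
    fun_prop
  obtain ⟨l, hl, hmin⟩ := (isCompact_univ_pi (fun _ : ℝ => isCompact_Icc (a := (0:ℝ)) (b := B))).exists_isMinOn
    ⟨fun _ => 0, fun _ _ => ⟨le_rfl, hB0.le⟩⟩ hcont.continuousOn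
  have hl0 : ∀ θ, 0 ≤ l θ := fun θ => (hl θ (Set.mem_univ _)).1
  have hlB : ∀ θ, l θ ≤ B := fun θ => (hl θ (Set.mem_univ _)).2
  have hWu : ∀ θ ∈ T, ∀ e v, W (Function.update l θ (l θ + e)) v = W l v + if θ ≤ v then e else 0 := by
    intro θ hθ e v
    have : ∀ x, Function.update l θ (l θ + e) x = l x + if x = θ then e else 0 := by
      intro x
      by_cases hx : x = θ
      · subst hx; simp
      · simp [hx]
    simp only [hW, this, Finset.sum_add_distrib]
    congr 1
    rw [Finset.sum_ite_eq']
    simp [hθ]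
  have hFu : ∀ θ ∈ T, ∀ e, F (Function.update l θ (l θ + e)) - F l =
      e * ((∑ v ∈ V with θ ≤ v, d v * W l v) - θ * P θ) + e ^ 2 / 2 * P θ := by
    intro θ hθ e
    have h1 : ∑ x ∈ T, Function.update l θ (l θ + e) x * (x * P x) =
        ∑ x ∈ T, l x * (x * P x) + e * (θ * P θ) := by
      have : ∀ x, Function.update l θ (l θ + e) x * (x * P x) =
          l x * (x * P x) + if x = θ then e * (x * P x) else 0 := by
        intro x
        by_cases hx : x = θ
        · subst hx; simp; ring
        · simp [hx]
      simp only [this, Finset.sum_add_distrib]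
      rw [Finset.sum_ite_eq']
      simp [hθ]
    have h2 : ∑ v ∈ V, d v * (W (Function.update l θ (l θ + e)) v) ^ 2 / 2 =
        ∑ v ∈ V, d v * (W l v) ^ 2 / 2 + (e * (∑ v ∈ V with θ ≤ v, d v * W l v)
          + e ^ 2 / 2 * P θ) := by
      simp only [hP, Finset.mul_sum, Finset.sum_filter]
      rw [← Finset.sum_add_distrib, ← Finset.sum_add_distrib]
      refine Finset.sum_congr rfl fun v _ => ?_
      rw [hWu θ hθ]
      split_ifs <;> ring
    simp only [hF]
    rw [h1, h2]; ring
  have hvar : ∀ θ ∈ T, ∀ e, 0 ≤ l θ + e → l θ + e ≤ B →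
      0 ≤ e * ((∑ v ∈ V with θ ≤ v, d v * W l v) - θ * P θ) + e ^ 2 / 2 * P θ := by
    intro θ hθ e h0 h1
    rw [← hFu θ hθ e]
    have : F l ≤ F (Function.update l θ (l θ + e)) := by
      apply hmin
      intro x _
      by_cases hx : x = θ
      · subst hx; simp [h0, h1]
      · simp [hx, hl0, hlB]
    linarith
  have hTP : ∀ θ ∈ T, 0 < P θ := fun θ hθ => (Finset.mem_filter.1 hθ).2
  have hTV : ∀ θ ∈ T, θ ∈ V := fun θ hθ => (Finset.mem_filter.1 hθ).1
  have hmono : Monotone (W l) := by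
    intro a b hab
    apply Finset.sum_le_sum_of_subset_of_nonneg
    · intro x hx
      simp only [Finset.mem_filter] at hx ⊢
      exact ⟨hx.1, hx.2.trans hab⟩
    · intro x _ _; exact hl0 x
  have hlow : ∀ θ, W l θ * P θ ≤ ∑ v ∈ V with θ ≤ v, d v * W l v := by
    intro θ
    simp only [hP, Finset.mul_sum]
    refine Finset.sum_le_sum fun v hv => ?_
    rw [mul_comm]
    exact mul_le_mul_of_nonneg_left (hmono (Finset.mem_filter.1 hv).2) (hd0 v)
  have hW0 : ∀ v, 0 ≤ W l v := fun v => Finset.sum_nonneg fun x _ => hl0 x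
  have hWl : ∀ θ ∈ T, l θ ≤ W l θ := by
    intro θ hθ
    apply Finset.single_le_sum (f := l) (fun x _ => hl0 x)
    simp [hθ]
  have hle : ∀ θ ∈ T, 0 < l θ → ∑ v ∈ V with θ ≤ v, d v * W l v ≤ θ * P θ := by
    intro θ hθ hpos
    have := quad_aux (r := l θ) (g := -((∑ v ∈ V with θ ≤ v, d v * W l v) - θ * P θ)) hpos (hTP θ hθ) (by
      intro e he0 he1
      have := hvar θ hθ (-e) (by linarith) (by linarith [hlB θ])
      linarith)
    linarith
  have hltB : ∀ θ ∈ T, l θ < B := by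
    intro θ hθ
    by_contra hc
    have heq : l θ = B := le_antisymm (hlB θ) (not_lt.1 hc)
    have h1 := hle θ hθ (by rw [heq]; exact hB0)
    have h2 := hlow θ
    have h3 := hWl θ hθ
    have h4 := hB θ (hTV θ hθ)
    have := mul_lt_mul_of_pos_right (show θ < W l θ by linarith) (hTP θ hθ)
    linarith
  have hge : ∀ θ ∈ T, θ * P θ ≤ ∑ v ∈ V with θ ≤ v, d v * W l v := by
    intro θ hθ
    have := quad_aux (r := B - l θ) (g := ((∑ v ∈ V with θ ≤ v, d v * W l v) - θ * P θ))
      (by linarith [hltB θ hθ]) (hTP θ hθ) (by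
      intro e he0 he1
      exact hvar θ hθ e (by linarith [hl0 θ]) (by linarith))
    linarith
  refine ⟨W l, hmono, hW0, ?_, ?_⟩
  · intro θ hθ
    by_cases hθT : θ ∈ T
    · exact hge θ hθT
    · have : P θ = 0 := by
        have h1 : ¬ 0 < P θ := fun h => hθT (Finset.mem_filter.2 ⟨hθ, h⟩)
        linarith [hP0 θ]
      change θ * P θ ≤ _
      rw [this, mul_zero]
      exact Finset.sum_nonneg fun v _ => mul_nonneg (hd0 v) (hW0 v)
  · intro θ hθ hpos hjump
    have key : θ ∈ T ∧ 0 < l θ := by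
      by_contra hc
      have h1 : W l θ = ∑ x ∈ T with x < θ, l x := by
        symm
        apply Finset.sum_subset
        · intro x hx
          simp only [Finset.mem_filter] at hx ⊢
          exact ⟨hx.1, hx.2.le⟩
        · intro x hx hx2
          simp only [Finset.mem_filter, not_and, not_lt] at hx hx2
          have : x = θ := le_antisymm hx.2 (hx2 hx.1)
          subst this
          have : ¬ 0 < l x := fun h => hc ⟨hx.1, h⟩
          linarith [hl0 x]
      rcases (T.filter (fun x => x < θ)).eq_empty_or_nonempty with he | hne
      · rw [h1, he] at hpos; simp at hpos
      · set t := (T.filter (fun x => x < θ)).max' hne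
        have ht := Finset.max'_mem _ hne
        have ht' := Finset.mem_filter.1 ht
        have h2 := hjump t (hTV _ ht'.1) ht'.2
        have h3 : W l θ ≤ W l t := by
          rw [h1]
          apply Finset.sum_le_sum_of_subset_of_nonneg
          · intro x hx
            have := Finset.le_max' _ x hx
            exact Finset.mem_filter.2 ⟨(Finset.mem_filter.1 hx).1, this⟩
          · intro x _ _; exact hl0 x
        linarith
    have heq := le_antisymm (hge θ key.1) (hle θ key.1 key.2)
    refine ⟨heq, ?_⟩
    have := hlow θ
    rw [← heq] at this
    exact le_of_mul_le_mul_right this (hTP θ key.1)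

/-- Decomposition of a monotone function into thresholds. -/
lemma decomp (V : Finset ℝ) (x p : ℝ → ℝ) (h0 : ∀ v ∈ V, 0 ≤ x v)
    (hm : ∀ a ∈ V, ∀ b ∈ V, a ≤ b → x a ≤ x b)
    (hir : ∀ v ∈ V, p v ≤ v * x v)
    (hic : ∀ a ∈ V, ∀ b ∈ V, a ≤ b → p b - p a ≤ b * (x b - x a)) :
    ∃ μ : ℝ → ℝ, (∀ θ, 0 ≤ μ θ) ∧ (∀ v ∈ V, x v = ∑ θ ∈ V with θ ≤ v, μ θ) ∧
      (∀ v ∈ V, p v ≤ ∑ θ ∈ V with θ ≤ v, θ * μ θ) := by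
  induction V using Finset.induction_on_max with
  | empty => exact ⟨0, by simp, by simp, by simp⟩
  | insert a s hs ih =>
    obtain ⟨μ, hμ0, hμx, hμp⟩ := ih (fun v hv => h0 v (by simp [hv]))
      (fun u hu b hb => hm u (by simp [hu]) b (by simp [hb]))
      (fun v hv => hir v (by simp [hv]))
      (fun u hu b hb => hic u (by simp [hu]) b (by simp [hb]))
    have ha : a ∉ s := fun h => lt_irrefl _ (hs a h)
    obtain ⟨c, hc0, hcx, hcp⟩ : ∃ c, 0 ≤ c ∧ x a = c + ∑ θ ∈ s, μ θ ∧
        p a ≤ a * c + ∑ θ ∈ s, θ * μ θ := by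
      rcases s.eq_empty_or_nonempty with he | hne
      · subst he
        exact ⟨x a, h0 a (by simp), by simp, by simpa using hir a (by simp)⟩
      · have hb := Finset.max'_mem s hne
        set b := s.max' hne
        have hfil : s.filter (fun θ => θ ≤ b) = s :=
          Finset.filter_true_of_mem fun y hy => Finset.le_max' s y hy
        have h1 := hμx b hb
        have h2 := hμp b hb
        rw [hfil] at h1 h2
        have hba := (hs b hb).le
        have h3 := hm b (by simp [hb]) a (by simp) hba
        have h4 := hic b (by simp [hb]) a (by simp) hba
        exact ⟨x a - x b, by linarith, by linarith, by linarith⟩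
    have hne : ∀ y ∈ s, y ≠ a := fun y hy h => ha (h ▸ hy)
    refine ⟨Function.update μ a c, ?_, ?_, ?_⟩
    · intro θ
      by_cases h : θ = a
      · subst h; simpa
      · simpa [h] using hμ0 θ
    · intro v hv
      rcases Finset.mem_insert.1 hv with rfl | hv
      · have : (insert v s).filter (fun θ => θ ≤ v) = insert v s :=
          Finset.filter_true_of_mem fun y hy => by
            rcases Finset.mem_insert.1 hy with rfl | hy
            · exact le_rfl
            · exact (hs y hy).le
        rw [this, Finset.sum_insert ha, Function.update_self, hcx]
        congr 1
        exact Finset.sum_congr rfl fun y hy => by rw [Function.update_of_ne (hne y hy)]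
      · rw [Finset.filter_insert, if_neg (not_le.2 (hs v hv)), hμx v hv]
        exact Finset.sum_congr rfl fun y hy => by
          rw [Function.update_of_ne (hne y (Finset.mem_filter.1 hy).1)]
    · intro v hv
      rcases Finset.mem_insert.1 hv with rfl | hv
      · have : (insert v s).filter (fun θ => θ ≤ v) = insert v s :=
          Finset.filter_true_of_mem fun y hy => by
            rcases Finset.mem_insert.1 hy with rfl | hy
            · exact le_rfl
            · exact (hs y hy).le
        rw [this, Finset.sum_insert ha, Function.update_self]
        refine hcp.trans (le_of_eq ?_)
        congr 1
        exact Finset.sum_congr rfl fun y hy => by rw [Function.update_of_ne (hne y hy)]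
      · rw [Finset.filter_insert, if_neg (not_le.2 (hs v hv))]
        refine (hμp v hv).trans (le_of_eq ?_)
        exact Finset.sum_congr rfl fun y hy => by
          rw [Function.update_of_ne (hne y (Finset.mem_filter.1 hy).1)]

lemma swap_thresh (V : Finset ℝ) (a b : ℝ → ℝ) :
    ∑ v ∈ V, a v * ∑ θ ∈ V with θ ≤ v, b θ = ∑ θ ∈ V, b θ * ∑ v ∈ V with θ ≤ v, a v := by
  simp only [Finset.sum_filter, Finset.mul_sum]
  rw [Finset.sum_comm]
  refine Finset.sum_congr rfl fun θ _ => Finset.sum_congr rfl fun v _ => ?_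
  split_ifs <;> ring

lemma single_upper (V : Finset ℝ) (d w x p : ℝ → ℝ) (hd : ∀ x, 0 ≤ d x)
    (hw : ∀ θ ∈ V, θ * ∑ v ∈ V with θ ≤ v, d v ≤ ∑ v ∈ V with θ ≤ v, d v * w v)
    (h0 : ∀ v ∈ V, 0 ≤ x v)
    (hir : ∀ v ∈ V, p v ≤ v * x v)
    (hic : ∀ a ∈ V, ∀ b ∈ V, a * x b - p b ≤ a * x a - p a) :
    ∑ v ∈ V, d v * p v ≤ ∑ v ∈ V, d v * (w v * x v) := by
  have hm : ∀ a ∈ V, ∀ b ∈ V, a ≤ b → x a ≤ x b := by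
    intro a ha b hb hab
    rcases hab.eq_or_lt with rfl | hlt
    · exact le_rfl
    · have h1 := hic a ha b hb
      have h2 := hic b hb a ha
      by_contra hc
      push Not at hc
      nlinarith
  obtain ⟨μ, hμ0, hμx, hμp⟩ := decomp V x p h0 hm hir (fun a ha b hb _ => by
    have := hic b hb a ha
    linarith)
  calc ∑ v ∈ V, d v * p v ≤ ∑ v ∈ V, d v * ∑ θ ∈ V with θ ≤ v, θ * μ θ :=
        Finset.sum_le_sum fun v hv => mul_le_mul_of_nonneg_left (hμp v hv) (hd v)
    _ = ∑ θ ∈ V, (θ * μ θ) * ∑ v ∈ V with θ ≤ v, d v := swap_thresh V d _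
    _ ≤ ∑ θ ∈ V, μ θ * ∑ v ∈ V with θ ≤ v, d v * w v := by
        refine Finset.sum_le_sum fun θ hθ => ?_
        have := mul_le_mul_of_nonneg_left (hw θ hθ) (hμ0 θ)
        linarith
    _ = ∑ v ∈ V, (d v * w v) * ∑ θ ∈ V with θ ≤ v, μ θ := (swap_thresh V _ _).symm
    _ = _ := by
        refine Finset.sum_congr rfl fun v hv => ?_
        rw [← hμx v hv]; ring

noncomputable def mx {n : ℕ} (w : Fin n → ℝ → ℝ) (v : Fin n → ℝ) : ℝ :=
  Finset.univ.fold max 0 (fun j => w j (v j))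

noncomputable def Wo {n : ℕ} (w : Fin n → ℝ → ℝ) (v : Fin n → ℝ) (i : Fin n) : ℝ :=
  (Finset.univ.erase i).fold max 0 (fun j => w j (v j))

def Win {n : ℕ} (w : Fin n → ℝ → ℝ) (v : Fin n → ℝ) (i : Fin n) : Prop :=
  0 < w i (v i) ∧ ∀ j, j ≠ i → w j (v j) ≤ w i (v i) ∧ (j < i → w j (v j) < w i (v i))

open Classical in
noncomputable def winSet {n : ℕ} (V : Finset ℝ) (w : Fin n → ℝ → ℝ) (v : Fin n → ℝ) (i : Fin n) :
    Finset ℝ := V.filter fun y => Win w (Function.update v i y) i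

open Classical in
noncomputable def thr {n : ℕ} (V : Finset ℝ) (w : Fin n → ℝ → ℝ) (v : Fin n → ℝ) (i : Fin n) : ℝ :=
  if h : (winSet V w v i).Nonempty then (winSet V w v i).min' h else 0

open Classical in
noncomputable def myerson {n : ℕ} (V : Finset ℝ) (w : Fin n → ℝ → ℝ) : Mech n where
  alloc v i := if Win w v i then 1 else 0
  pay v i := if Win w v i then thr V w v i else 0

lemma mx_eq {n : ℕ} (w : Fin n → ℝ → ℝ) (v : Fin n → ℝ) (i : Fin n) :
    mx w v = max (w i (v i)) (Wo w v i) := by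
  unfold mx Wo
  have := Finset.fold_insert (op := max) (b := (0:ℝ)) (f := fun j => w j (v j))
    (Finset.notMem_erase i Finset.univ)
  rw [Finset.insert_erase (Finset.mem_univ i)] at this
  exact this

lemma Wo_update {n : ℕ} (w : Fin n → ℝ → ℝ) (v : Fin n → ℝ) (i : Fin n) (y : ℝ) :
    Wo w (Function.update v i y) i = Wo w v i := by
  unfold Wo
  apply Finset.fold_congr
  intro j hj
  rw [Function.update_of_ne (Finset.ne_of_mem_erase hj)]

lemma Wo_nonneg {n : ℕ} (w : Fin n → ℝ → ℝ) (v : Fin n → ℝ) (i : Fin n) : 0 ≤ Wo w v i :=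
  (Finset.le_fold_max _).2 (Or.inl le_rfl)

lemma le_Wo {n : ℕ} (w : Fin n → ℝ → ℝ) (v : Fin n → ℝ) {i j : Fin n} (h : j ≠ i) :
    w j (v j) ≤ Wo w v i :=
  (Finset.le_fold_max _).2 (Or.inr ⟨j, by simp [h], le_rfl⟩)

lemma mx_nonneg {n : ℕ} (w : Fin n → ℝ → ℝ) (v : Fin n → ℝ) : 0 ≤ mx w v :=
  (Finset.le_fold_max _).2 (Or.inl le_rfl)

lemma le_mx {n : ℕ} (w : Fin n → ℝ → ℝ) (v : Fin n → ℝ) (j : Fin n) :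
    w j (v j) ≤ mx w v :=
  (Finset.le_fold_max _).2 (Or.inr ⟨j, by simp, le_rfl⟩)

lemma win_Wo {n : ℕ} {w : Fin n → ℝ → ℝ} {v : Fin n → ℝ} {i : Fin n} (h : Win w v i) :
    Wo w v i ≤ w i (v i) :=
  (Finset.fold_max_le _).2 ⟨h.1.le, fun j hj => (h.2 j (Finset.ne_of_mem_erase hj)).1⟩

lemma not_win_Wo {n : ℕ} {w : Fin n → ℝ → ℝ} {v : Fin n → ℝ} {i : Fin n} (h : ¬ Win w v i) :
    w i (v i) ≤ Wo w v i := by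
  by_contra hc
  push Not at hc
  apply h
  refine ⟨(Wo_nonneg w v i).trans_lt hc, fun j hj => ?_⟩
  have := (le_Wo w v hj).trans_lt hc
  exact ⟨this.le, fun _ => this⟩

lemma win_mono {n : ℕ} {w : Fin n → ℝ → ℝ} {v : Fin n → ℝ} {i : Fin n} {y z : ℝ}
    (h : Win w (Function.update v i y) i) (hyz : w i y ≤ w i z) :
    Win w (Function.update v i z) i := by
  obtain ⟨h1, h2⟩ := h
  simp only [Function.update_self] at h1 h2
  refine ⟨by simpa using h1.trans_le hyz, fun j hj => ?_⟩
  have := h2 j hj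
  rw [Function.update_of_ne hj] at this
  rw [Function.update_of_ne hj, Function.update_self]
  exact ⟨this.1.trans hyz, fun hlt => (this.2 hlt).trans_le hyz⟩

lemma win_unique {n : ℕ} {w : Fin n → ℝ → ℝ} {v : Fin n → ℝ} {i j : Fin n}
    (hi : Win w v i) (hj : Win w v j) : i = j := by
  by_contra hne
  rcases lt_or_gt_of_ne hne with h | h
  · have h1 := (hj.2 i hne).2 h
    have h2 := (hi.2 j (Ne.symm hne)).1
    linarith
  · have h1 := (hi.2 j (Ne.symm hne)).2 h
    have h2 := (hj.2 i hne).1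
    linarith

lemma exists_win {n : ℕ} {w : Fin n → ℝ → ℝ} {v : Fin n → ℝ} (h : 0 < mx w v) :
    ∃ i, Win w v i := by
  classical
  set S : Finset (Fin n) := Finset.univ.filter fun i => mx w v ≤ w i (v i) with hS
  have hne : S.Nonempty := by
    have := (Finset.le_fold_max (s := Finset.univ) (b := 0) (f := fun j => w j (v j)) (mx w v)).1 le_rfl
    rcases this with h' | ⟨i, _, hi⟩
    · linarith
    · exact ⟨i, by simpa [hS] using hi⟩
  have hi := Finset.min'_mem S hne
  set i := S.min' hne
  have hi' : mx w v ≤ w i (v i) := (Finset.mem_filter.1 hi).2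
  refine ⟨i, h.trans_le hi', fun j _ => ⟨(le_mx w v j).trans hi', fun hlt => ?_⟩⟩
  by_contra hc
  push Not at hc
  have : i ≤ j := Finset.min'_le S j (by simpa [hS] using hi'.trans hc)
  exact absurd hlt (not_lt.2 this)

lemma winSet_update {n : ℕ} (V : Finset ℝ) (w : Fin n → ℝ → ℝ) (v : Fin n → ℝ) (i : Fin n) (y : ℝ) :
    winSet V w (Function.update v i y) i = winSet V w v i := by
  classical
  ext z
  unfold winSet
  rw [Finset.mem_filter, Finset.mem_filter, Function.update_idem]

lemma thr_update {n : ℕ} (V : Finset ℝ) (w : Fin n → ℝ → ℝ) (v : Fin n → ℝ) (i : Fin n) (y : ℝ) :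
    thr V w (Function.update v i y) i = thr V w v i := by
  unfold thr
  simp only [winSet_update]

/-- Characterization of winning by the threshold. -/
lemma win_iff_thr {n : ℕ} {V : Finset ℝ} {w : Fin n → ℝ → ℝ} (hw : ∀ i, Monotone (w i))
    {v : Fin n → ℝ} {i : Fin n} (hne : (winSet V w v i).Nonempty) {y : ℝ} (hy : y ∈ V) :
    Win w (Function.update v i y) i ↔ thr V w v i ≤ y := by
  have ht : thr V w v i = (winSet V w v i).min' hne := by simp [thr, hne]
  constructor
  · intro h
    rw [ht]
    exact Finset.min'_le _ _ (by simp [winSet, hy, h])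
  · intro h
    have h1 := Finset.min'_mem _ hne
    rw [← ht] at h1
    classical
    unfold winSet at h1
    exact win_mono (Finset.mem_filter.1 h1).2 (hw i h)

lemma myerson_mem {n : ℕ} {V : Finset ℝ} {w : Fin n → ℝ → ℝ} (hw : ∀ i, Monotone (w i)) :
    myerson V w ∈ Mechs n V := by
  classical
  have key : ∀ (v : Fin n → ℝ) i, v i ∈ V → (Win w v i → thr V w v i ≤ v i) := by
    intro v i hv h
    have hne : (winSet V w v i).Nonempty := ⟨v i, by simp [winSet, hv, h]⟩
    have := (win_iff_thr hw hne hv).1 (by simpa using h)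
    exact this
  refine ⟨?_, ?_, ?_⟩
  · intro v hv
    refine ⟨fun i => ?_, ?_⟩
    · simp only [myerson]
      split_ifs <;> simp
    · simp only [myerson, Finset.sum_boole]
      have : (Finset.univ.filter fun i => Win w v i).card ≤ 1 := by
        rw [Finset.card_le_one]
        intro a ha b hb
        exact win_unique (Finset.mem_filter.1 ha).2 (Finset.mem_filter.1 hb).2
      exact_mod_cast this
  · intro i v hv y hy
    simp only [myerson, thr_update]
    by_cases h1 : Win w (Function.update v i y) i
    · have hne : (winSet V w v i).Nonempty := ⟨y, by simp [winSet, hy, h1]⟩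
      have h2 := win_iff_thr hw hne (hv i)
      rw [Function.update_eq_self] at h2
      by_cases h3 : Win w v i
      · simp [h1, h3]
      · have : ¬ thr V w v i ≤ v i := fun h => h3 (h2.2 h)
        simp [h1, h3]; linarith
    · by_cases h3 : Win w v i
      · simp [h1, h3, key v i (hv i) h3]
      · simp [h1, h3]
  · intro v hv i
    simp only [myerson]
    split_ifs with h
    · have := key v i (hv i) h
      linarith
    · simp

lemma tail_dom {V : Finset ℝ} {d d' : ℝ → ℝ} (h1 : ∑ x ∈ V, d x = 1) (h1' : ∑ x ∈ V, d' x = 1)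
    (hdom : Dominates1 V d' d) (S : ℝ → Prop) [DecidablePred S]
    (hS : ∀ a b, a ≤ b → S b → S a) :
    ∑ x ∈ V with S x, d' x ≤ ∑ x ∈ V with S x, d x := by
  rcases (V.filter S).eq_empty_or_nonempty with he | hne
  · simp [he]
  · set t := (V.filter S).max' hne
    have ht := Finset.mem_filter.1 (Finset.max'_mem _ hne)
    have : V.filter S = V.filter (fun x => x ≤ t) := by
      ext x
      simp only [Finset.mem_filter]
      constructor
      · intro hx
        exact ⟨hx.1, Finset.le_max' _ x (Finset.mem_filter.2 hx)⟩
      · intro hx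
        exact ⟨hx.1, hS _ _ hx.2 ht.2⟩
    rw [this]
    exact hdom t

lemma single_lower {n : ℕ} {V : Finset ℝ} {w : Fin n → ℝ → ℝ} (hw : ∀ i, Monotone (w i))
    (v : Fin n → ℝ) (i : Fin n) (d d' : ℝ → ℝ) (hd : IsDist1 V d) (hd' : IsDist1 V d')
    (hdom : Dominates1 V d' d)
    (hj : ∀ θ ∈ V, 0 < w i θ → (∀ θ' ∈ V, θ' < θ → w i θ' < w i θ) →
        θ * ∑ v ∈ V with θ ≤ v, d v = ∑ v ∈ V with θ ≤ v, d v * w i v ∧ w i θ ≤ θ) :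
    ∑ y ∈ V, d' y * (Wo w v i * (myerson V w).alloc (Function.update v i y) i) +
      (∑ y ∈ V, d y * mx w (Function.update v i y) - Wo w v i) ≤
    ∑ y ∈ V, d' y * (myerson V w).pay (Function.update v i y) i := by
  classical
  have hW : Wo w v i = ∑ y ∈ V, d y * Wo w v i := by
    rw [← Finset.sum_mul, hd.2.2, one_mul]
  have hA : ∑ y ∈ V, d y * mx w (Function.update v i y) - Wo w v i =
      ∑ y ∈ V, d y * (mx w (Function.update v i y) - Wo w v i) := by
    conv_lhs => rw [hW]
    rw [← Finset.sum_sub_distrib]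
    exact Finset.sum_congr rfl fun y _ => by rw [mul_sub]
  rw [hA]
  have hmx : ∀ y, mx w (Function.update v i y) = max (w i y) (Wo w v i) := by
    intro y
    rw [mx_eq w _ i, Wo_update, Function.update_self]
  simp only [myerson, thr_update, hmx]
  rcases (winSet V w v i).eq_empty_or_nonempty with he | hne
  · have hno : ∀ y ∈ V, ¬ Win w (Function.update v i y) i := by
      intro y hy h
      have : y ∈ winSet V w v i := by simp [winSet, hy, h]
      simp [he] at this
    have e1 : ∀ y ∈ V, d y * (max (w i y) (Wo w v i) - Wo w v i) = 0 := by
      intro y hy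
      have := not_win_Wo (hno y hy)
      rw [Wo_update, Function.update_self] at this
      rw [max_eq_right this]; ring
    rw [Finset.sum_congr rfl e1]
    have e2 : ∀ y ∈ V, d' y * (Wo w v i * (if Win w (Function.update v i y) i then 1 else 0)) = 0 :=
      fun y hy => by simp [hno y hy]
    have e3 : ∀ y ∈ V, d' y * (if Win w (Function.update v i y) i then thr V w v i else 0) = 0 :=
      fun y hy => by simp [hno y hy]
    rw [Finset.sum_congr rfl e2, Finset.sum_congr rfl e3]
    simp
  · have hiff := fun y (hy : y ∈ V) => win_iff_thr hw hne hy
    have ht : thr V w v i = (winSet V w v i).min' hne := by simp [thr, hne]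
    have htm := Finset.min'_mem _ hne
    rw [← ht] at htm
    set t := thr V w v i
    have htV : t ∈ V := (Finset.mem_filter.1 htm).1
    have htW : Win w (Function.update v i t) i := (Finset.mem_filter.1 htm).2
    obtain ⟨heq, hwt⟩ := hj t htV (by simpa using htW.1) (by
      intro y hy hlt
      by_contra hc
      push Not at hc
      have := (hiff y hy).1 (win_mono htW hc)
      linarith)
    have hWt : Wo w v i ≤ t := by
      have := win_Wo htW
      rw [Wo_update, Function.update_self] at this
      exact this.trans hwt
    have e1 : ∑ y ∈ V, d y * (max (w i y) (Wo w v i) - Wo w v i) =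
        ∑ y ∈ V with t ≤ y, d y * (w i y - Wo w v i) := by
      rw [Finset.sum_filter]
      refine Finset.sum_congr rfl fun y hy => ?_
      split_ifs with h
      · have := win_Wo ((hiff y hy).2 h)
        rw [Wo_update, Function.update_self] at this
        rw [max_eq_left this]
      · have := not_win_Wo (fun h' => h ((hiff y hy).1 h'))
        rw [Wo_update, Function.update_self] at this
        rw [max_eq_right this]; ring
    have e2 : ∑ y ∈ V with t ≤ y, d y * (w i y - Wo w v i) =
        (t - Wo w v i) * ∑ y ∈ V with t ≤ y, d y := by
      simp only [mul_sub, Finset.sum_sub_distrib, ← heq, ← Finset.sum_mul]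
      ring
    have e3 : ∀ c : ℝ, ∑ y ∈ V, d' y * (if Win w (Function.update v i y) i then c else 0) =
        c * ∑ y ∈ V with t ≤ y, d' y := by
      intro c
      rw [Finset.mul_sum, Finset.sum_filter]
      refine Finset.sum_congr rfl fun y hy => ?_
      simp only [hiff y hy]
      split_ifs <;> ring
    have e4 : ∑ y ∈ V, d' y * (Wo w v i * (if Win w (Function.update v i y) i then 1 else 0)) =
        Wo w v i * ∑ y ∈ V with t ≤ y, d' y := by
      rw [← e3]
      refine Finset.sum_congr rfl fun y hy => ?_
      split_ifs <;> ring
    rw [e1, e2, e3, e4]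
    have hPP : ∑ y ∈ V with t ≤ y, d y ≤ ∑ y ∈ V with t ≤ y, d' y := by
      have h1 := tail_dom hd.2.2 hd'.2.2 hdom (fun y => ¬ t ≤ y) (fun a b hab hb h => hb (h.trans hab))
      have h2 := Finset.sum_filter_add_sum_filter_not V (fun y => t ≤ y) d
      have h3 := Finset.sum_filter_add_sum_filter_not V (fun y => t ≤ y) d'
      rw [hd.2.2] at h2
      rw [hd'.2.2] at h3
      linarith
    have := mul_le_mul_of_nonneg_left hPP (sub_nonneg.2 hWt)
    linarith

lemma resample {n : ℕ} (V : Finset ℝ) (d : Fin n → ℝ → ℝ) (i : Fin n) (e : ℝ → ℝ)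
    (hd : ∑ y ∈ V, d i y = 1) (f : (Fin n → ℝ) → ℝ) :
    ∑ v ∈ Fintype.piFinset (fun _ : Fin n => V), (∏ j, Function.update d i e j (v j)) * f v =
    ∑ v ∈ Fintype.piFinset (fun _ : Fin n => V), (∏ j, d j (v j)) *
      ∑ y ∈ V, e y * f (Function.update v i y) := by
  have hsplit : ∀ (g : Fin n → ℝ → ℝ) (v : Fin n → ℝ),
      ∏ j, g j (v j) = g i (v i) * ∏ j ∈ Finset.univ.erase i, g j (v j) := fun g v =>
    (Finset.mul_prod_erase _ _ (Finset.mem_univ i)).symm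
  have hL : ∀ v ∈ Fintype.piFinset (fun _ : Fin n => V),
      (∏ j, Function.update d i e j (v j)) * f v =
      ∑ z ∈ V, d i z * (e (v i) * (∏ j ∈ Finset.univ.erase i, d j (v j)) * f v) := by
    intro v _
    rw [← Finset.sum_mul, hd, one_mul, hsplit, Function.update_self]
    congr 2
    exact Finset.prod_congr rfl fun j hj => by
      rw [Function.update_of_ne (Finset.ne_of_mem_erase hj)]
  rw [Finset.sum_congr rfl hL]
  simp only [Finset.mul_sum]
  rw [← Finset.sum_product', ← Finset.sum_product']
  refine Finset.sum_nbij' (fun q => (Function.update q.1 i q.2, q.1 i))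
    (fun q => (Function.update q.1 i q.2, q.1 i)) ?_ ?_ ?_ ?_ ?_
  · rintro ⟨v, y⟩ h
    simp only [Finset.mem_product, Fintype.mem_piFinset] at h ⊢
    refine ⟨fun j => ?_, h.1 i⟩
    by_cases hj : j = i
    · subst hj; simpa using h.2
    · simpa [hj] using h.1 j
  · rintro ⟨v, y⟩ h
    simp only [Finset.mem_product, Fintype.mem_piFinset] at h ⊢
    refine ⟨fun j => ?_, h.1 i⟩
    by_cases hj : j = i
    · subst hj; simpa using h.2
    · simpa [hj] using h.1 j
  · rintro ⟨v, y⟩ _; simp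
  · rintro ⟨v, y⟩ _; simp
  · rintro ⟨v, y⟩ _
    simp only [Function.update_idem, Function.update_eq_self]
    rw [hsplit d, Function.update_self]
    have : ∏ j ∈ Finset.univ.erase i, d j (Function.update v i y j) =
        ∏ j ∈ Finset.univ.erase i, d j (v j) :=
      Finset.prod_congr rfl fun j hj => by
        rw [Function.update_of_ne (Finset.ne_of_mem_erase hj)]
    rw [this]; ring

lemma resample_self {n : ℕ} (V : Finset ℝ) (d : Fin n → ℝ → ℝ) (i : Fin n)
    (hd : ∑ y ∈ V, d i y = 1) (f : (Fin n → ℝ) → ℝ) :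
    ∑ v ∈ Fintype.piFinset (fun _ : Fin n => V), (∏ j, d j (v j)) * f v =
    ∑ v ∈ Fintype.piFinset (fun _ : Fin n => V), (∏ j, d j (v j)) *
      ∑ y ∈ V, d i y * f (Function.update v i y) := by
  have := resample V d i (d i) hd f
  rwa [Function.update_eq_self] at this

lemma prod_ineq {ι : Type*} [DecidableEq ι] (s : Finset ι) (F F' : ι → ℝ) (h0 : ∀ i, 0 ≤ F' i)
    (h : ∀ i, F' i ≤ F i) :
    ∑ j ∈ s, ∏ k ∈ s, Function.update F' j (F j) k ≤ ∏ k ∈ s, F k + (s.card - 1) * ∏ k ∈ s, F' k := by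
  induction s using Finset.induction_on with
  | empty => simp
  | insert a s ha ih =>
    rw [Finset.sum_insert ha]
    have h1 : ∏ k ∈ insert a s, Function.update F' a (F a) k = F a * ∏ k ∈ s, F' k := by
      rw [Finset.prod_insert ha, Function.update_self]
      congr 1
      exact Finset.prod_congr rfl fun k hk => by
        rw [Function.update_of_ne (ne_of_mem_of_not_mem hk ha)]
    have h2 : ∀ j ∈ s, ∏ k ∈ insert a s, Function.update F' j (F j) k =
        F' a * ∏ k ∈ s, Function.update F' j (F j) k := by
      intro j hj
      rw [Finset.prod_insert ha, Function.update_of_ne (ne_of_mem_of_not_mem hj ha).symm]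
    rw [h1, Finset.sum_congr rfl h2, ← Finset.mul_sum, Finset.prod_insert ha, Finset.prod_insert ha,
      Finset.card_insert_of_notMem ha]
    have h3 := mul_le_mul_of_nonneg_left ih (h0 a)
    have h4 : ∏ k ∈ s, F' k ≤ ∏ k ∈ s, F k :=
      Finset.prod_le_prod (fun i _ => h0 i) (fun i _ => h i)
    have h5 := mul_nonneg (sub_nonneg.2 (h a)) (sub_nonneg.2 h4)
    push_cast
    nlinarith

lemma sum_pi_prod {n : ℕ} (V : Finset ℝ) (d : Fin n → ℝ → ℝ) :
    ∑ v ∈ Fintype.piFinset (fun _ : Fin n => V), ∏ j, d j (v j) = ∏ j, ∑ y ∈ V, d j y :=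
  (Finset.prod_univ_sum (fun _ => V) d).symm

/-- Layer-cake formula for the expected maximum. -/
lemma layer {n : ℕ} (V : Finset ℝ) (w : Fin n → ℝ → ℝ) (hw0 : ∀ i y, 0 ≤ w i y) :
    ∃ (L : Finset ℝ) (μ : ℝ → ℝ), (∀ l, 0 ≤ μ l) ∧ ∀ d : Fin n → ℝ → ℝ,
      (∀ i, ∑ y ∈ V, d i y = 1) →
      ∑ v ∈ Fintype.piFinset (fun _ : Fin n => V), (∏ j, d j (v j)) * mx w v =
      ∑ l ∈ L, μ l * (1 - ∏ j, ∑ y ∈ V with w j y < l, d j y) := by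
  classical
  set L0 : Finset ℝ := insert 0 (Finset.univ.biUnion fun i => V.image (w i)) with hL0
  have hL00 : ∀ l ∈ L0, 0 ≤ l := by
    intro l hl
    simp only [hL0, Finset.mem_insert, Finset.mem_biUnion, Finset.mem_image] at hl
    rcases hl with rfl | ⟨i, _, y, _, rfl⟩
    · exact le_rfl
    · exact hw0 i y
  obtain ⟨μ, hμ0, hμx, _⟩ := decomp L0 (fun x => x) (fun x => -x) hL00 (fun _ _ _ _ h => h)
    (fun v hv => by have := hL00 v hv; nlinarith)
    (fun a ha b hb hab => by have := hL00 b hb; have := mul_nonneg this (sub_nonneg.2 hab); linarith)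
  refine ⟨L0.erase 0, μ, hμ0, fun d hd => ?_⟩
  have hμz : μ 0 = 0 := by
    have := hμx 0 (by simp [hL0])
    have h2 : L0.filter (fun θ => θ ≤ 0) = {0} := by
      ext x
      simp only [Finset.mem_filter, Finset.mem_singleton]
      constructor
      · intro h; exact le_antisymm h.2 (hL00 x h.1)
      · rintro rfl; exact ⟨by simp [hL0], le_rfl⟩
    rw [h2] at this
    simpa using this.symm
  have hmem : ∀ v ∈ Fintype.piFinset (fun _ : Fin n => V), mx w v ∈ L0 := by
    intro v hv
    rw [Fintype.mem_piFinset] at hv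
    have := (Finset.le_fold_max (s := Finset.univ) (b := 0) (f := fun j => w j (v j)) (mx w v)).1 le_rfl
    rcases this with h' | ⟨i, _, hi⟩
    · have : mx w v = 0 := le_antisymm h' (mx_nonneg w v)
      simp [this, hL0]
    · have : mx w v = w i (v i) := le_antisymm hi (le_mx w v i)
      rw [this]
      refine Finset.mem_insert_of_mem (Finset.mem_biUnion.2 ⟨i, Finset.mem_univ _, ?_⟩)
      exact Finset.mem_image_of_mem _ (hv i)
  have hind : ∀ v, ∀ l ∈ L0.erase 0, (if l ≤ mx w v then (1:ℝ) else 0) =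
      1 - ∏ j, (if w j (v j) < l then 1 else 0) := by
    intro v l hl
    have hlpos : 0 < l := lt_of_le_of_ne (hL00 l (Finset.mem_of_mem_erase hl)) (Ne.symm (Finset.ne_of_mem_erase hl))
    split_ifs with h
    · rcases (Finset.le_fold_max (s := Finset.univ) (b := 0) (f := fun j => w j (v j)) l).1 h with h' | ⟨i, _, hi⟩
      · linarith
      · rw [Finset.prod_eq_zero (Finset.mem_univ i) (by simp [hi])]; simp
    · rw [Finset.prod_eq_one]
      · simp
      · intro j _
        have := (le_mx w v j).trans_lt (not_le.1 h)
        simp [this]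
  have hexp : ∀ v ∈ Fintype.piFinset (fun _ : Fin n => V), (∏ j, d j (v j)) * mx w v =
      ∑ l ∈ L0.erase 0, μ l * ((∏ j, d j (v j)) - ∏ j, (if w j (v j) < l then d j (v j) else 0)) := by
    intro v hv
    conv_lhs => rw [hμx _ (hmem v hv)]
    rw [Finset.sum_filter, ← Finset.sum_erase (a := 0) L0 (by simp [hμz]), Finset.mul_sum]
    refine Finset.sum_congr rfl fun l hl => ?_
    have h1 : ∏ j, (if w j (v j) < l then d j (v j) else 0) =
        (∏ j, d j (v j)) * ∏ j, (if w j (v j) < l then (1:ℝ) else 0) := by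
      rw [← Finset.prod_mul_distrib]
      exact Finset.prod_congr rfl fun j _ => by simp
    have h2 := hind v l hl
    have h3 : (if l ≤ mx w v then μ l else 0) = μ l * (if l ≤ mx w v then (1:ℝ) else 0) := by simp
    rw [h3, h2, h1]; ring
  rw [Finset.sum_congr rfl hexp, Finset.sum_comm]
  refine Finset.sum_congr rfl fun l _ => ?_
  rw [← Finset.mul_sum, Finset.sum_sub_distrib, sum_pi_prod,
    sum_pi_prod V (fun j y => if w j y < l then d j y else 0)]
  simp [hd, Finset.sum_filter]

lemma mx_ineq {n : ℕ} (V : Finset ℝ) (w : Fin n → ℝ → ℝ) (hw0 : ∀ i y, 0 ≤ w i y)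
    (hw : ∀ i, Monotone (w i)) (d d' : Fin n → ℝ → ℝ) (hd : ∀ i, IsDist1 V (d i))
    (hd' : ∀ i, IsDist1 V (d' i)) (hdom : ∀ i, Dominates1 V (d' i) (d i)) :
    ∑ v ∈ Fintype.piFinset (fun _ : Fin n => V), (∏ j, d j (v j)) * mx w v +
      (n - 1) * ∑ v ∈ Fintype.piFinset (fun _ : Fin n => V), (∏ j, d' j (v j)) * mx w v ≤
    ∑ i, ∑ v ∈ Fintype.piFinset (fun _ : Fin n => V),
      (∏ j, Function.update d' i (d i) j (v j)) * mx w v := by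
  obtain ⟨L, μ, hμ, h⟩ := layer V w hw0
  have hu : ∀ i j, ∑ y ∈ V, Function.update d' i (d i) j y = 1 := by
    intro i j
    by_cases hj : j = i
    · subst hj; simpa using (hd j).2.2
    · simpa [hj] using (hd' j).2.2
  rw [h d fun i => (hd i).2.2, h d' fun i => (hd' i).2.2,
    Finset.sum_congr rfl fun i _ => h (Function.update d' i (d i)) (hu i), Finset.sum_comm,
    Finset.mul_sum, ← Finset.sum_add_distrib]
  refine Finset.sum_le_sum fun l _ => ?_
  have hp := prod_ineq Finset.univ (fun j => ∑ y ∈ V with w j y < l, d j y)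
    (fun j => ∑ y ∈ V with w j y < l, d' j y)
    (fun i => Finset.sum_nonneg fun y _ => (hd' i).1 y)
    (fun i => tail_dom (hd i).2.2 (hd' i).2.2 (hdom i) (fun y => w i y < l)
      (fun a b hab hb => (hw i hab).trans_lt hb))
  have he : ∀ i, ∏ j, ∑ y ∈ V with w j y < l, Function.update d' i (d i) j y =
      ∏ k, Function.update (fun j => ∑ y ∈ V with w j y < l, d' j y) i
        (∑ y ∈ V with w i y < l, d i y) k := by
    intro i
    refine Finset.prod_congr rfl fun k _ => ?_
    by_cases hk : k = i
    · subst hk; simp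
    · simp [hk]
  simp only [he]
  rw [← Finset.mul_sum, Finset.sum_sub_distrib]
  simp only [Finset.sum_const, Finset.card_univ, Fintype.card_fin, nsmul_eq_mul, mul_one] at hp ⊢
  have := mul_le_mul_of_nonneg_left hp (hμ l)
  linarith

lemma lower {n : ℕ} (V : Finset ℝ) (w : Fin n → ℝ → ℝ) (hw0 : ∀ i y, 0 ≤ w i y)
    (hw : ∀ i, Monotone (w i)) (d d' : Fin n → ℝ → ℝ) (hd : ∀ i, IsDist1 V (d i))
    (hd' : ∀ i, IsDist1 V (d' i)) (hdom : ∀ i, Dominates1 V (d' i) (d i))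
    (hj : ∀ i, ∀ θ ∈ V, 0 < w i θ → (∀ θ' ∈ V, θ' < θ → w i θ' < w i θ) →
        θ * ∑ v ∈ V with θ ≤ v, d i v = ∑ v ∈ V with θ ≤ v, d i v * w i v ∧ w i θ ≤ θ) :
    ∑ v ∈ Fintype.piFinset (fun _ : Fin n => V), (∏ j, d j (v j)) * mx w v ≤
      RevF V (myerson V w) (fun v => ∏ i, d' i (v i)) := by
  classical
  set Q := Fintype.piFinset (fun _ : Fin n => V)
  set D' : (Fin n → ℝ) → ℝ := fun v => ∏ i, d' i (v i)
  have hD' : ∀ v, 0 ≤ D' v := fun v => Finset.prod_nonneg fun i _ => (hd' i).1 _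
  have h1 : ∀ i, ∑ v ∈ Q, D' v * (Wo w v i * (myerson V w).alloc v i) +
      (∑ v ∈ Q, (∏ j, Function.update d' i (d i) j (v j)) * mx w v - ∑ v ∈ Q, D' v * Wo w v i) ≤
      ∑ v ∈ Q, D' v * (myerson V w).pay v i := by
    intro i
    rw [resample_self V d' i (hd' i).2.2 (fun v => Wo w v i * (myerson V w).alloc v i),
      resample_self V d' i (hd' i).2.2 (fun v => (myerson V w).pay v i),
      resample V d' i (d i) (hd' i).2.2, ← Finset.sum_sub_distrib, ← Finset.sum_add_distrib]
    refine Finset.sum_le_sum fun v _ => ?_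
    have := mul_le_mul_of_nonneg_left
      (single_lower hw v i (d i) (d' i) (hd i) (hd' i) (hdom i) (hj i)) (hD' v)
    simp only [Wo_update]
    simp only [D'] at this ⊢
    linarith
  have h2 := Finset.sum_le_sum fun i (_ : i ∈ Finset.univ) => h1 i
  have h3 := mx_ineq V w hw0 hw d d' hd hd' hdom
  have hpath : ∀ v, ∑ i, (Wo w v i - Wo w v i * (myerson V w).alloc v i) ≤ (n - 1) * mx w v := by
    intro v
    have hle : ∀ i, Wo w v i ≤ mx w v := fun i => by rw [mx_eq w v i]; exact le_max_right _ _
    rcases (mx_nonneg w v).eq_or_lt with h0 | hpos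
    · rw [← h0, mul_zero]
      refine Finset.sum_nonpos fun i _ => ?_
      have : Wo w v i = 0 := le_antisymm ((hle i).trans h0.ge) (Wo_nonneg w v i)
      simp [this]
    · obtain ⟨k, hk⟩ := exists_win hpos
      have hb : ∀ i, Wo w v i - Wo w v i * (myerson V w).alloc v i ≤
          mx w v - if i = k then mx w v else 0 := by
        intro i
        by_cases hi : i = k
        · subst hi; simp [myerson, hk]
        · have : ¬ Win w v i := fun h => hi (win_unique h hk)
          simp [myerson, this, hi, hle i]
      refine (Finset.sum_le_sum fun i _ => hb i).trans (le_of_eq ?_)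
      simp [Finset.sum_sub_distrib]
      ring
  have h4 : ∑ v ∈ Q, D' v * ∑ i, (Wo w v i - Wo w v i * (myerson V w).alloc v i) ≤
      (n - 1) * ∑ v ∈ Q, D' v * mx w v := by
    rw [Finset.mul_sum]
    refine Finset.sum_le_sum fun v _ => ?_
    have := mul_le_mul_of_nonneg_left (hpath v) (hD' v)
    linarith
  have h5 : ∑ v ∈ Q, D' v * ∑ i, (Wo w v i - Wo w v i * (myerson V w).alloc v i) =
      ∑ i, ∑ v ∈ Q, D' v * Wo w v i - ∑ i, ∑ v ∈ Q, D' v * (Wo w v i * (myerson V w).alloc v i) := by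
    simp only [Finset.mul_sum]
    rw [Finset.sum_comm, ← Finset.sum_sub_distrib]
    refine Finset.sum_congr rfl fun i _ => ?_
    rw [← Finset.sum_sub_distrib]
    exact Finset.sum_congr rfl fun v _ => by ring
  have h6 : RevF V (myerson V w) D' = ∑ i, ∑ v ∈ Q, D' v * (myerson V w).pay v i := by
    simp only [RevF, Finset.mul_sum]
    rw [Finset.sum_comm]
  rw [h6]
  rw [Finset.sum_add_distrib, Finset.sum_sub_distrib] at h2
  simp only [D'] at *
  linarith

lemma upper {n : ℕ} (V : Finset ℝ) (w : Fin n → ℝ → ℝ)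
    (d : Fin n → ℝ → ℝ) (hd : ∀ i, IsDist1 V (d i))
    (hw : ∀ i, ∀ θ ∈ V, θ * ∑ v ∈ V with θ ≤ v, d i v ≤ ∑ v ∈ V with θ ≤ v, d i v * w i v)
    (M : Mech n) (hM : M ∈ Mechs n V) :
    RevF V M (fun v => ∏ i, d i (v i)) ≤
    ∑ v ∈ Fintype.piFinset (fun _ : Fin n => V), (∏ j, d j (v j)) * mx w v := by
  obtain ⟨hval, hic, hir⟩ := hM
  set Q := Fintype.piFinset (fun _ : Fin n => V) with hQ
  have hD : ∀ v : Fin n → ℝ, 0 ≤ ∏ i, d i (v i) :=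
    fun v => Finset.prod_nonneg fun i _ => (hd i).1 _
  have hupd : ∀ v ∈ Q, ∀ i, ∀ y ∈ V, ∀ j, Function.update v i y j ∈ V := by
    intro v hv i y hy j
    rw [hQ, Fintype.mem_piFinset] at hv
    by_cases hj : j = i
    · subst hj; simpa
    · simpa [hj] using hv j
  have h1 : ∀ i, ∑ v ∈ Q, (∏ i, d i (v i)) * M.pay v i ≤
      ∑ v ∈ Q, (∏ i, d i (v i)) * (w i (v i) * M.alloc v i) := by
    intro i
    rw [resample_self V d i (hd i).2.2 (fun v => M.pay v i),
      resample_self V d i (hd i).2.2 (fun v => w i (v i) * M.alloc v i)]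
    refine Finset.sum_le_sum fun v hv => mul_le_mul_of_nonneg_left ?_ (hD v)
    simp only [Function.update_self]
    refine single_upper V (d i) (w i) (fun y => M.alloc (Function.update v i y) i)
      (fun y => M.pay (Function.update v i y) i) (hd i).1 (hw i) ?_ ?_ ?_
    · intro y hy
      exact ((hval _ (hupd v hv i y hy)).1 i).1
    · intro y hy
      have := hir _ (hupd v hv i y hy) i
      simp only [Function.update_self] at this
      linarith
    · intro a ha b hb
      have := hic i _ (hupd v hv i a ha) b hb
      simpa using this
  calc RevF V M (fun v => ∏ i, d i (v i)) = ∑ i, ∑ v ∈ Q, (∏ i, d i (v i)) * M.pay v i := by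
        simp only [RevF, Finset.mul_sum]
        rw [Finset.sum_comm]
    _ ≤ ∑ i, ∑ v ∈ Q, (∏ i, d i (v i)) * (w i (v i) * M.alloc v i) :=
        Finset.sum_le_sum fun i _ => h1 i
    _ = ∑ v ∈ Q, (∏ i, d i (v i)) * ∑ i, w i (v i) * M.alloc v i := by
        rw [Finset.sum_comm]
        simp only [Finset.mul_sum]
    _ ≤ _ := by
        refine Finset.sum_le_sum fun v hv => mul_le_mul_of_nonneg_left ?_ (hD v)
        rw [hQ, Fintype.mem_piFinset] at hv
        have hv' := hval v hv
        calc ∑ i, w i (v i) * M.alloc v i ≤ ∑ i, mx w v * M.alloc v i :=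
              Finset.sum_le_sum fun i _ => mul_le_mul_of_nonneg_right (le_mx w v i) (hv'.1 i).1
          _ = mx w v * ∑ i, M.alloc v i := by rw [Finset.mul_sum]
          _ ≤ mx w v * 1 := mul_le_mul_of_nonneg_left hv'.2 (mx_nonneg w v)
          _ = _ := mul_one _

/-- **`D₀` minimizes the optimal revenue.** Fix a finite set `V ⊂ [0,∞)` and a
product pmf `d₀` on `Vⁿ`.  Let `𝔇` be the convex hull of the set of product
pmfs on `Vⁿ` that component-wise first-order stochastically dominate `d₀`, and
let `g(D) = sup_{M∈ℳ} Rev(M,D)` over DSIC and IR mechanisms on `Vⁿ`.  Then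
`g(D) ≥ g(D₀)` for every `D ∈ 𝔇`. -/
theorem d0_minimizes_opt {n : ℕ} (hn : 1 ≤ n) (V : Finset ℝ)
    (hV : ∀ x ∈ V, (0 : ℝ) ≤ x) (hVne : V.Nonempty)
    (d₀ : Fin n → ℝ → ℝ) (hd₀ : ∀ i, IsDist1 V (d₀ i)) :
    ∀ d ∈ convexHull ℝ (ProdDoms V d₀),
      gOpt n V (fun v => ∏ i, d₀ i (v i)) ≤ gOpt n V d := by
  classical
  choose w hmono hw0 hup hj using fun i => ironed V (d₀ i) (hd₀ i)
  have hmem : myerson V w ∈ Mechs n V := myerson_mem hmono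
  intro d hd
  set c := ∑ v ∈ Fintype.piFinset (fun _ : Fin n => V), (∏ j, d₀ j (v j)) * mx w v with hc
  have hset : d ∈ {d : (Fin n → ℝ) → ℝ | (∀ v, 0 ≤ d v) ∧ c ≤ RevF V (myerson V w) d} := by
    refine convexHull_min ?_ ?_ hd
    · rintro e ⟨m, hm1, hm2, rfl⟩
      exact ⟨fun v => Finset.prod_nonneg fun i _ => (hm1 i).1 _,
        lower V w hw0 hmono d₀ m hd₀ hm1 hm2 hj⟩
    · rintro e ⟨he0, he1⟩ f ⟨hf0, hf1⟩ a b ha hb hab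
      refine ⟨fun v => ?_, ?_⟩
      · simpa using add_nonneg (mul_nonneg ha (he0 v)) (mul_nonneg hb (hf0 v))
      · have : RevF V (myerson V w) (a • e + b • f) =
            a * RevF V (myerson V w) e + b * RevF V (myerson V w) f := by
          simp only [RevF, Finset.mul_sum _ _ a, Finset.mul_sum _ _ b, ← Finset.sum_add_distrib]
          refine Finset.sum_congr rfl fun v _ => ?_
          simp only [Pi.add_apply, Pi.smul_apply, smul_eq_mul]
          rw [add_mul, mul_assoc, mul_assoc]
        rw [this]
        have h1 := mul_le_mul_of_nonneg_left he1 ha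
        have h2 := mul_le_mul_of_nonneg_left hf1 hb
        have h3 : c = a * c + b * c := by rw [← add_mul, hab, one_mul]
        linarith
  obtain ⟨hd0, hdc⟩ := hset
  haveI : Nonempty (Mechs n V) := ⟨⟨_, hmem⟩⟩
  have hbdd : BddAbove (Set.range fun M : Mechs n V => RevF V M.1 d) := by
    refine ⟨∑ v ∈ Fintype.piFinset (fun _ : Fin n => V), d v * ∑ i, v i, ?_⟩
    rintro _ ⟨⟨M, hval, hic, hir⟩, rfl⟩
    refine Finset.sum_le_sum fun v hv => mul_le_mul_of_nonneg_left ?_ (hd0 v)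
    rw [Fintype.mem_piFinset] at hv
    refine Finset.sum_le_sum fun i _ => ?_
    have h1 := hir v hv i
    have h2 := mul_le_mul_of_nonneg_left ((hval v hv).1 i).2 (hV _ (hv i))
    linarith
  calc gOpt n V (fun v => ∏ i, d₀ i (v i)) ≤ c :=
        ciSup_le fun M => upper V w d₀ hd₀ hup M.1 M.2
    _ ≤ RevF V (myerson V w) d := hdc
    _ ≤ gOpt n V d := le_ciSup hbdd (⟨_, hmem⟩ : Mechs n V)
end
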